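/- arXiv:1112.1236 — 2 statements merged into one kernel-verified Lean document; each statement's English description precedes it below -/
import Mathlib

section
/- Let D be a countable integral domain and * a stable star operation of finite character on D such that D is *-sharp. Then D is a *-Dedekind domain. -/
open scoped nonZeroDivisors

/-- A star operation on an integral domain `D` with quotient field `K`: a map
`I ↦ I*` on (nonzero) fractional ideals such that `D* = D`, `(aI)* = a·I*`,
`I ⊆ I*`, `I ⊆ J → I* ⊆ J*` and `(I*)* = I*`. (The value at `0` is irrelevant.) -/
structure StarOperation (D K : Type*) [CommRing D] [IsDomain D] [Field K]
    [Algebra D K] [IsFractionRing D K] where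
  star : FractionalIdeal D⁰ K → FractionalIdeal D⁰ K
  star_one : star 1 = 1
  star_smul : ∀ (a : K), a ≠ 0 → ∀ I : FractionalIdeal D⁰ K, I ≠ 0 →
    star (FractionalIdeal.spanSingleton D⁰ a * I) = FractionalIdeal.spanSingleton D⁰ a * star I
  le_star : ∀ I : FractionalIdeal D⁰ K, I ≠ 0 → I ≤ star I
  star_mono : ∀ I J : FractionalIdeal D⁰ K, I ≠ 0 → J ≠ 0 → I ≤ J → star I ≤ star J
  star_star : ∀ I : FractionalIdeal D⁰ K, I ≠ 0 → star (star I) = star I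

section StarSharpDefs

variable {D K : Type*} [CommRing D] [IsDomain D] [Field K] [Algebra D K] [IsFractionRing D K]

/-- `D` is sharp with respect to the operation `star` ("`*`-sharp"): whenever
`I ⊇ A·B` for nonzero ideals `I, A, B` of `D`, there exist nonzero ideals `H, J`
with `I* = (HJ)*`, `H* ⊇ A` and `J* ⊇ B`. -/
def IsSharpOp (star : FractionalIdeal D⁰ K → FractionalIdeal D⁰ K) : Prop :=
  ∀ I A B : Ideal D, I ≠ 0 → A ≠ 0 → B ≠ 0 → A * B ≤ I →
    ∃ H J : Ideal D, H ≠ 0 ∧ J ≠ 0 ∧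
      star (I : FractionalIdeal D⁰ K) =
        star ((H : FractionalIdeal D⁰ K) * (J : FractionalIdeal D⁰ K)) ∧
      (A : FractionalIdeal D⁰ K) ≤ star (H : FractionalIdeal D⁰ K) ∧
      (B : FractionalIdeal D⁰ K) ≤ star (J : FractionalIdeal D⁰ K)

/-- `D` is `*`-sharp for the star operation `s`. -/
def StarOperation.IsSharp (s : StarOperation D K) : Prop :=
  IsSharpOp s.star

/-- A star operation is stable if it distributes over (finite) intersections of
nonzero fractional ideals. -/
def StarOperation.IsStable (s : StarOperation D K) : Prop :=
  ∀ I J : FractionalIdeal D⁰ K, I ≠ 0 → J ≠ 0 → s.star (I ⊓ J) = s.star I ⊓ s.star J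

/-- A star operation has finite character if `I*` is the union of `H*` over the
nonzero finitely generated subideals `H` of `I`. -/
def StarOperation.HasFiniteCharacter (s : StarOperation D K) : Prop :=
  ∀ I : FractionalIdeal D⁰ K, I ≠ 0 → ∀ x ∈ s.star I,
    ∃ H : FractionalIdeal D⁰ K, H ≠ 0 ∧ (H : Submodule D K).FG ∧ H ≤ I ∧ x ∈ s.star H

/-- `D` is `*`-Dedekind if every nonzero fractional ideal `I` is `*`-invertible,
i.e. `(I·I⁻¹)* = D`. -/
def StarOperation.IsStarDedekind (s : StarOperation D K) : Prop :=
  ∀ I : FractionalIdeal D⁰ K, I ≠ 0 → s.star (I * I⁻¹) = 1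

end StarSharpDefs

section CompleteOrderedGroup

variable {G : Type*} [CommGroup G] [PartialOrder G] [IsOrderedMonoid G]

/-- In a countable conditionally complete ordered commutative group, every element below `1`
lies below a maximal one. -/
theorem exists_maximal_lt_one_of_countable [Countable G]
    (hsup : ∀ S : Set G, S.Nonempty → BddAbove S → ∃ z, IsLUB S z) {x : G} (hx : x < 1) :
    ∃ p, x ≤ p ∧ Maximal (· < 1) p := by
  by_contra hcon
  have dense : ∀ c, x ≤ c → c < 1 → ∃ d, c < d ∧ d < 1 := by
    intro c hxc hc
    by_contra hd
    push Not at hd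
    refine hcon ⟨c, hxc, hc, fun q hq hcq => ?_⟩
    by_contra hqc
    exact hd q (lt_of_le_not_ge hcq hqc) hq
  have step : ∀ (g : G) (u : {u : G × G // u.1 < u.2 ∧ x * u.2 ≤ u.1}),
      ∃ v : {u : G × G // u.1 < u.2 ∧ x * u.2 ≤ u.1},
        u.1.1 ≤ v.1.1 ∧ v.1.2 ≤ u.1.2 ∧ ¬ (v.1.1 ≤ g ∧ g ≤ v.1.2) := by
    rintro g ⟨⟨a, b⟩, hab, hxab⟩
    dsimp only at hab hxab
    obtain ⟨k, hk, hk1⟩ := dense (a * b⁻¹) (le_mul_inv_iff_mul_le.2 hxab)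
      (mul_inv_lt_iff_lt_mul.2 (by simpa using hab))
    have hak : a < k * b := mul_inv_lt_iff_lt_mul.1 hk
    have hxk : x ≤ k := (le_mul_inv_iff_mul_le.2 hxab).trans hk.le
    obtain ⟨l, hl, hl1⟩ := dense k hxk hk1
    have hkb : k * b < l * b := mul_lt_mul_left hl b
    have hlb : l * b < b := mul_lt_of_lt_one_left' b hl1
    by_cases hg : g ≤ k * b
    · exact ⟨⟨(l * b, b), hlb, hxab.trans (hak.trans hkb).le⟩, (hak.trans hkb).le, le_rfl,
        fun h => absurd (h.1.trans hg) hkb.not_ge⟩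
    · exact ⟨⟨(a, k * b), hak, (mul_le_mul_right (hkb.trans hlb).le x).trans hxab⟩, le_rfl,
        (hkb.trans hlb).le, fun h => hg h.2⟩
  choose next hnext using step
  obtain ⟨f, hf⟩ := exists_surjective_nat G
  let u : ℕ → {u : G × G // u.1 < u.2 ∧ x * u.2 ≤ u.1} :=
    fun n => Nat.rec ⟨(x, 1), hx, by simp⟩ (fun n v => next (f n) v) n
  have hu : ∀ n, u (n + 1) = next (f n) (u n) := fun n => rfl
  have hmono : Monotone fun n => (u n).1.1 :=
    monotone_nat_of_le_succ fun n => by simpa only [hu] using (hnext (f n) (u n)).1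
  have hanti : Antitone fun n => (u n).1.2 :=
    antitone_nat_of_succ_le fun n => by simpa only [hu] using (hnext (f n) (u n)).2.1
  have hle : ∀ m n, (u m).1.1 ≤ (u n).1.2 := fun m n =>
    (hmono (le_max_left m n)).trans ((u (max m n)).2.1.le.trans (hanti (le_max_right m n)))
  obtain ⟨z, hz⟩ := hsup (Set.range fun n => (u n).1.1) (Set.range_nonempty _)
    ⟨(u 0).1.2, by rintro _ ⟨m, rfl⟩; exact hle m 0⟩
  obtain ⟨n, rfl⟩ := hf z
  refine (hnext (f n) (u n)).2.2 ⟨?_, ?_⟩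
  · exact hz.1 ⟨n + 1, rfl⟩
  · exact hz.2 (by rintro _ ⟨m, rfl⟩; exact hle m (n + 1))

/-- In a countable conditionally complete ordered commutative group, an element lies below only
finitely many maximal elements of `{p | p < 1}`. -/
theorem finite_maximal_lt_one_of_countable [Countable G]
    (hsup : ∀ S : Set G, S.Nonempty → BddAbove S → ∃ z, IsLUB S z) {x : G} (hx : x ≤ 1) :
    {p | x ≤ p ∧ Maximal (· < 1) p}.Finite := by
  set T := {p | x ≤ p ∧ Maximal (· < 1) p}
  have hinf : ∀ S : Set T, ∃ z : G, IsGLB (insert 1 ((↑) '' S)) z := by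
    intro S
    have hb : BddBelow (insert 1 ((↑) '' S : Set G)) := by
      refine ⟨x, ?_⟩
      rintro _ (rfl | ⟨p, -, rfl⟩)
      · exact hx
      · exact p.2.1
    obtain ⟨z, hz⟩ := hsup (lowerBounds (insert 1 (Subtype.val '' S))) hb
      ⟨1, fun y hy => hy (Set.mem_insert _ _)⟩
    exact ⟨z, isLUB_lowerBounds.1 hz⟩
  choose inf hinf using hinf
  have key : ∀ (S : Set T) (p : T), inf S ≤ p → p ∈ S := by
    intro S p hp
    by_contra hpS
    have h1 : inf S * (p : G)⁻¹ ≤ inf S := by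
      refine (hinf S).2 ?_
      rintro _ (rfl | ⟨q, hq, rfl⟩)
      · exact mul_inv_le_iff_le_mul.2 (by simpa using hp)
      · have hqS : inf S ≤ q := (hinf S).1 (Set.mem_insert_of_mem _ ⟨q, hq, rfl⟩)
        have hqp : ¬ (q : G) ≤ p := fun h => by
          have : q = p := Subtype.ext (le_antisymm h (q.2.2.2 p.2.2.1 h))
          exact hpS (this ▸ hq)
        obtain ⟨y, hy⟩ := hsup {(p : G), (q : G)} ⟨_, Set.mem_insert _ _⟩
          ⟨1, by rintro _ (rfl | rfl); exacts [p.2.2.1.le, q.2.2.1.le]⟩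
        have hpy : (p : G) ≤ y := hy.1 (by simp)
        have hqy : (q : G) ≤ y := hy.1 (by simp)
        have hy1 : y ≤ 1 := hy.2 (by rintro _ (rfl | rfl); exacts [p.2.2.1.le, q.2.2.1.le])
        have hy1' : y = 1 := by
          by_contra hne
          exact hqp (hqy.trans (p.2.2.2 (lt_of_le_of_ne hy1 hne) hpy))
        have hub : y ≤ p * q * (inf S)⁻¹ := by
          refine hy.2 ?_
          rintro _ (rfl | rfl)
          · rw [le_mul_inv_iff_mul_le]
            exact mul_le_mul_right hqS _
          · rw [le_mul_inv_iff_mul_le, mul_comm (p : G)]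
            exact mul_le_mul_right hp _
        rw [hy1', le_mul_inv_iff_mul_le, one_mul, mul_comm] at hub
        exact mul_inv_le_iff_le_mul.2 hub
    rw [mul_inv_le_iff_le_mul] at h1
    exact p.2.2.1.not_ge ((le_mul_iff_one_le_right' _).1 h1)
  have hinj : Function.Injective inf := by
    intro S S' h
    ext p
    constructor
    · intro hp
      exact key _ _ (h ▸ (hinf S).1 (Set.mem_insert_of_mem _ ⟨p, hp, rfl⟩))
    · intro hp
      exact key _ _ (h ▸ (hinf S').1 (Set.mem_insert_of_mem _ ⟨p, hp, rfl⟩))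
  by_contra hfin
  have : Infinite T := Set.infinite_coe_iff.2 hfin
  have hc : Countable (Set T) := hinj.countable
  obtain ⟨f, hf⟩ := exists_surjective_nat (Set T)
  exact Function.cantor_surjective _
    (hf.comp (Function.invFun_surjective (Infinite.natEmbedding T).injective))

end CompleteOrderedGroup

namespace StarOperation

open FractionalIdeal

section FractionalIdealLemmas

variable {D K : Type*} [CommRing D] [Field K] [Algebra D K]

theorem ne_zero_of_le {I J : FractionalIdeal D⁰ K} (hI : I ≠ 0) (h : I ≤ J) : J ≠ 0 := by
  rintro rfl
  exact hI (FractionalIdeal.le_zero_iff.1 h)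

theorem add_inf_le_of_le {I J L : FractionalIdeal D⁰ K} (h : J ≤ L) :
    (I + J) ⊓ L ≤ I ⊓ L + J := by
  intro x hx
  obtain ⟨hx, hxL⟩ : x ∈ I + J ∧ x ∈ L := hx
  obtain ⟨i, hi, j, hj, rfl⟩ := (FractionalIdeal.mem_add I J x).1 hx
  refine (FractionalIdeal.mem_add _ _ _).2 ⟨i, ⟨hi, ?_⟩, j, hj, rfl⟩
  have := (L : Submodule D K).sub_mem hxL (h hj)
  simpa using this

variable [IsDomain D] [IsFractionRing D K]

instance : NoZeroDivisors (FractionalIdeal D⁰ K) where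
  eq_zero_or_eq_zero_of_mul_eq_zero {I J} h := by
    by_contra! hIJ
    obtain ⟨a, ha, haI⟩ := exists_ne_zero_mem_isInteger hIJ.1
    obtain ⟨b, hb, hbJ⟩ := exists_ne_zero_mem_isInteger hIJ.2
    have hab := FractionalIdeal.mul_mem_mul haI hbJ
    rw [h, FractionalIdeal.mem_zero_iff, ← map_mul] at hab
    exact mul_ne_zero ha hb ((IsFractionRing.injective D K) (by simpa using hab))

theorem le_inv_iff_mul_le_one {I J : FractionalIdeal D⁰ K} (hJ : J ≠ 0) :
    I ≤ J⁻¹ ↔ I * J ≤ 1 :=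
  FractionalIdeal.le_div_iff_mul_le hJ

theorem inv_ne_zero' {I : FractionalIdeal D⁰ K} (hI : I ≠ 0) : I⁻¹ ≠ 0 := by
  intro h
  have := bot_lt_mul_inv (I := I) hI
  simp [h] at this

theorem mul_inv_le_one (I : FractionalIdeal D⁰ K) : I * I⁻¹ ≤ 1 :=
  mul_one_div_le_one

theorem le_inv_inv {I : FractionalIdeal D⁰ K} (hI : I ≠ 0) : I ≤ I⁻¹⁻¹ :=
  (le_inv_iff_mul_le_one (inv_ne_zero' hI)).2 (mul_inv_le_one I)

theorem inf_ne_zero {I J : FractionalIdeal D⁰ K} (hI : I ≠ 0) (hJ : J ≠ 0) : I ⊓ J ≠ 0 := by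
  obtain ⟨a, ha, haI⟩ := exists_ne_zero_mem_isInteger hI
  obtain ⟨b, hb, hbJ⟩ := exists_ne_zero_mem_isInteger hJ
  intro h
  have hab : algebraMap D K (a * b) ∈ I ⊓ J := by
    refine ⟨?_, ?_⟩
    · rw [mul_comm, map_mul, ← Algebra.smul_def]
      exact (I : Submodule D K).smul_mem b haI
    · rw [map_mul, ← Algebra.smul_def]
      exact (J : Submodule D K).smul_mem a hbJ
  rw [h, FractionalIdeal.mem_zero_iff] at hab
  exact mul_ne_zero ha hb ((IsFractionRing.injective D K) (by simpa using hab))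

end FractionalIdealLemmas

variable {D K : Type*} [CommRing D] [IsDomain D] [Field K] [Algebra D K] [IsFractionRing D K]

variable (s : StarOperation D K)

theorem star_ne_zero {I : FractionalIdeal D⁰ K} (hI : I ≠ 0) : s.star I ≠ 0 :=
  ne_zero_of_le hI (s.le_star I hI)

variable {s}

theorem star_le_star {I J : FractionalIdeal D⁰ K} (hI : I ≠ 0) (h : I ≤ J) :
    s.star I ≤ s.star J :=
  s.star_mono I J hI (ne_zero_of_le hI h) h

theorem star_le_of_le_star {I J : FractionalIdeal D⁰ K} (hI : I ≠ 0) (hJ : J ≠ 0)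
    (h : I ≤ s.star J) : s.star I ≤ s.star J :=
  (star_le_star hI h).trans_eq (s.star_star J hJ)

variable (s)

theorem mul_star_le (I : FractionalIdeal D⁰ K) {J : FractionalIdeal D⁰ K} (hJ : J ≠ 0) :
    I * s.star J ≤ s.star (I * J) := by
  refine FractionalIdeal.mul_le.2 fun i hi j hj => ?_
  by_cases hi0 : i = 0
  · rw [hi0, zero_mul]
    exact FractionalIdeal.zero_mem _
  have h0 : spanSingleton D⁰ i * J ≠ 0 := mul_ne_zero (spanSingleton_ne_zero_iff.2 hi0) hJ
  refine star_le_star h0 (mul_le_mul_left (spanSingleton_le_iff_mem.2 hi) J) ?_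
  rw [s.star_smul i hi0 J hJ]
  exact FractionalIdeal.mul_mem_mul (mem_spanSingleton_self _ i) hj

theorem star_mul_star {I J : FractionalIdeal D⁰ K} (hI : I ≠ 0) (hJ : J ≠ 0) :
    s.star (I * s.star J) = s.star (I * J) :=
  le_antisymm
    (star_le_of_le_star (mul_ne_zero hI (s.star_ne_zero hJ)) (mul_ne_zero hI hJ)
      (s.mul_star_le _ hJ))
    (star_le_star (mul_ne_zero hI hJ) (mul_le_mul_right (s.le_star J hJ) I))

theorem star_star_mul {I J : FractionalIdeal D⁰ K} (hI : I ≠ 0) (hJ : J ≠ 0) :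
    s.star (s.star I * J) = s.star (I * J) := by
  rw [mul_comm, s.star_mul_star hJ hI, mul_comm]

theorem star_le_one {I : FractionalIdeal D⁰ K} (hI : I ≠ 0) (h : I ≤ 1) : s.star I ≤ 1 :=
  (star_le_star hI h).trans_eq s.star_one

theorem star_inv {I : FractionalIdeal D⁰ K} (hI : I ≠ 0) : s.star I⁻¹ = I⁻¹ := by
  have hI' := inv_ne_zero' hI
  refine le_antisymm ((le_inv_iff_mul_le_one hI).2 ?_) (s.le_star _ hI')
  rw [mul_comm]
  exact (s.mul_star_le _ hI').trans (s.star_le_one (mul_ne_zero hI hI') (mul_inv_le_one I))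

theorem inv_star {I : FractionalIdeal D⁰ K} (hI : I ≠ 0) : (s.star I)⁻¹ = I⁻¹ := by
  have hs := s.star_ne_zero hI
  have hI' := inv_ne_zero' hI
  refine le_antisymm (inv_anti_mono hI hs (s.le_star I hI)) ((le_inv_iff_mul_le_one hs).2 ?_)
  refine (s.mul_star_le _ hI).trans (s.star_le_one (mul_ne_zero hI' hI) ?_)
  rw [mul_comm]
  exact mul_inv_le_one I

/-- `I` is `*`-invertible. -/
def IsInvertible (I : FractionalIdeal D⁰ K) : Prop :=
  I ≠ 0 ∧ s.star (I * I⁻¹) = 1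

variable {s}

theorem isInvertible_of_star_mul_eq_one {I J : FractionalIdeal D⁰ K} (hI : I ≠ 0) (hJ : J ≠ 0)
    (h : s.star (I * J) = 1) : s.IsInvertible I := by
  refine ⟨hI, le_antisymm (s.star_le_one (mul_ne_zero hI (inv_ne_zero' hI)) (mul_inv_le_one I)) ?_⟩
  rw [← h]
  refine star_le_star (mul_ne_zero hI hJ) (mul_le_mul_right ?_ I)
  rw [le_inv_iff_mul_le_one hI, ← h, mul_comm]
  exact s.le_star _ (mul_ne_zero hI hJ)

namespace IsInvertible

variable {I J A B : FractionalIdeal D⁰ K}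

theorem ne_zero (hI : s.IsInvertible I) : I ≠ 0 := hI.1

theorem inv_ne_zero (hI : s.IsInvertible I) : I⁻¹ ≠ 0 := inv_ne_zero' hI.1

theorem inv (hI : s.IsInvertible I) : s.IsInvertible I⁻¹ :=
  isInvertible_of_star_mul_eq_one hI.inv_ne_zero hI.1 (by rw [mul_comm, hI.2])

theorem le_star_mul_mul_inv (hI : s.IsInvertible I) (A : FractionalIdeal D⁰ K) :
    A ≤ s.star (A * (I * I⁻¹)) := by
  simpa [hI.2] using s.mul_star_le _ (mul_ne_zero hI.ne_zero hI.inv_ne_zero)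

theorem le_star_of_mul_le (hI : s.IsInvertible I) (hA : A ≠ 0) (hB : B ≠ 0)
    (h : A * I ≤ s.star (B * I)) : A ≤ s.star B := by
  have hBI := mul_ne_zero hB hI.ne_zero
  have h0 := mul_ne_zero hI.ne_zero hI.inv_ne_zero
  calc A ≤ s.star (A * (I * I⁻¹)) := hI.le_star_mul_mul_inv _
    _ ≤ s.star (s.star (B * I) * I⁻¹) := by
        rw [← mul_assoc]
        exact star_le_star (mul_ne_zero (mul_ne_zero hA hI.ne_zero) hI.inv_ne_zero)
          (mul_le_mul_left h _)
    _ = s.star (B * s.star (I * I⁻¹)) := by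
        rw [s.star_star_mul hBI hI.inv_ne_zero, mul_assoc, s.star_mul_star hB h0]
    _ = s.star B := by rw [hI.2, mul_one]

theorem star (hI : s.IsInvertible I) : s.IsInvertible (s.star I) := by
  refine ⟨s.star_ne_zero hI.1, ?_⟩
  rw [s.inv_star hI.1, s.star_star_mul hI.1 hI.inv_ne_zero, hI.2]

theorem mul (hI : s.IsInvertible I) (hJ : s.IsInvertible J) : s.IsInvertible (I * J) := by
  refine isInvertible_of_star_mul_eq_one (J := I⁻¹ * J⁻¹) (mul_ne_zero hI.1 hJ.1)
    (mul_ne_zero hI.inv_ne_zero hJ.inv_ne_zero) ?_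
  rw [mul_mul_mul_comm, ← s.star_mul_star (mul_ne_zero hI.1 hI.inv_ne_zero)
    (mul_ne_zero hJ.1 hJ.inv_ne_zero), hJ.2, mul_one, hI.2]

theorem inv_inv (hI : s.IsInvertible I) : I⁻¹⁻¹ = s.star I := by
  refine le_antisymm (hI.inv.le_star_of_mul_le hI.inv.inv_ne_zero hI.1 ?_) ?_
  · rw [hI.2, mul_comm]
    exact mul_inv_le_one _
  · rw [← s.star_inv hI.inv_ne_zero]
    exact star_le_star hI.1 (le_inv_inv hI.1)

end IsInvertible

theorem isInvertible_one : s.IsInvertible 1 :=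
  isInvertible_of_star_mul_eq_one one_ne_zero one_ne_zero (by rw [mul_one, s.star_one])

theorem isInvertible_spanSingleton {a : K} (ha : a ≠ 0) :
    s.IsInvertible (spanSingleton D⁰ a) :=
  ⟨spanSingleton_ne_zero_iff.2 ha, by rw [spanSingleton_mul_inv K ha, s.star_one]⟩

theorem IsSharp.exists_of_mul_le (hs : s.IsSharp) {I A B : FractionalIdeal D⁰ K} (hI : I ≠ 0)
    (hA : A ≠ 0) (hB : B ≠ 0) (h : A * B ≤ I) :
    ∃ H J : FractionalIdeal D⁰ K, H ≠ 0 ∧ J ≠ 0 ∧ s.star I = s.star (H * J) ∧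
      A ≤ s.star H ∧ B ≤ s.star J := by
  obtain ⟨x, y, hx, hy, I', A', B', hI', hA', hB'⟩ : ∃ x y : K, x ≠ 0 ∧ y ≠ 0 ∧
      ∃ I' A' B' : Ideal D, I = spanSingleton D⁰ (x * y) * (I' : FractionalIdeal D⁰ K) ∧
        A = spanSingleton D⁰ x * (A' : FractionalIdeal D⁰ K) ∧
        B = spanSingleton D⁰ y * (B' : FractionalIdeal D⁰ K) := by
    obtain ⟨a, I', ha, hI'⟩ := exists_eq_spanSingleton_mul I
    obtain ⟨b, A', hb, hA'⟩ := exists_eq_spanSingleton_mul A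
    obtain ⟨c, B', hc, hB'⟩ := exists_eq_spanSingleton_mul B
    have ha' : algebraMap D K a ≠ 0 := by simpa using ha
    have hb' : algebraMap D K b ≠ 0 := by simpa using hb
    have hc' : algebraMap D K c ≠ 0 := by simpa using hc
    refine ⟨(algebraMap D K (a * b))⁻¹, (algebraMap D K c)⁻¹, by simp [ha, hb],
      by simpa using hc, Ideal.span {b * c} * I', Ideal.span {a} * A', B', ?_, ?_, hB'⟩
    · rw [hI', coeIdeal_mul, coeIdeal_span_singleton, ← mul_assoc,
        spanSingleton_mul_spanSingleton]
      congr 2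
      simp only [map_mul]
      field_simp
    · rw [hA', coeIdeal_mul, coeIdeal_span_singleton, ← mul_assoc,
        spanSingleton_mul_spanSingleton]
      congr 2
      simp only [map_mul]
      field_simp
  have hxy := mul_ne_zero hx hy
  subst hI' hA' hB'
  have hI0 := right_ne_zero_of_mul hI
  have hA0 := right_ne_zero_of_mul hA
  have hB0 := right_ne_zero_of_mul hB
  have h' : A' * B' ≤ I' := by
    rw [← coeIdeal_le_coeIdeal K, coeIdeal_mul]
    rw [mul_mul_mul_comm, spanSingleton_mul_spanSingleton] at h
    have := mul_le_mul_right h (spanSingleton D⁰ (x * y)⁻¹)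
    simpa only [← mul_assoc, spanSingleton_mul_spanSingleton, inv_mul_cancel₀ hxy,
      spanSingleton_one, one_mul] using this
  obtain ⟨H, J, hH, hJ, hIHJ, hAH, hBJ⟩ := hs I' A' B' (coeIdeal_ne_zero.1 hI0)
    (coeIdeal_ne_zero.1 hA0) (coeIdeal_ne_zero.1 hB0) h'
  have hH0 : (H : FractionalIdeal D⁰ K) ≠ 0 := coeIdeal_ne_zero.2 hH
  have hJ0 : (J : FractionalIdeal D⁰ K) ≠ 0 := coeIdeal_ne_zero.2 hJ
  refine ⟨spanSingleton D⁰ x * H, spanSingleton D⁰ y * J,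
    mul_ne_zero (spanSingleton_ne_zero_iff.2 hx) hH0,
    mul_ne_zero (spanSingleton_ne_zero_iff.2 hy) hJ0, ?_, ?_, ?_⟩
  · rw [mul_mul_mul_comm, spanSingleton_mul_spanSingleton, s.star_smul _ hxy _ hI0, hIHJ,
      s.star_smul _ hxy _ (mul_ne_zero hH0 hJ0)]
  · rw [s.star_smul _ hx _ hH0]
    exact mul_le_mul_right hAH _
  · rw [s.star_smul _ hy _ hJ0]
    exact mul_le_mul_right hBJ _

/-- In a `*`-sharp domain, inverses of nonzero fractional ideals are `*`-invertible. -/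
theorem IsSharp.isInvertible_inv (hs : s.IsSharp) {A : FractionalIdeal D⁰ K} (hA : A ≠ 0) :
    s.IsInvertible A⁻¹ := by
  obtain ⟨H, J, hH, hJ, h1, hAH, hAJ⟩ := hs.exists_of_mul_le (one_ne_zero) hA (inv_ne_zero' hA)
    (mul_inv_le_one A)
  rw [s.star_one] at h1
  have hHinv : s.IsInvertible H := isInvertible_of_star_mul_eq_one hH hJ h1.symm
  have hJH : J ≤ H⁻¹ := by
    rw [le_inv_iff_mul_le_one hH, h1, mul_comm]
    exact s.le_star _ (mul_ne_zero hH hJ)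
  have : A⁻¹ = H⁻¹ := by
    refine le_antisymm (hAJ.trans ?_) ?_
    · rw [← s.star_inv hH]
      exact star_le_star hJ hJH
    · rw [← s.inv_star hH]
      exact inv_anti_mono hA (s.star_ne_zero hH) hAH
  rw [this]
  exact hHinv.inv

theorem IsInvertible.inf_le_star_mul {X Y : FractionalIdeal D⁰ K} (hX : s.IsInvertible X)
    (hY : s.IsInvertible Y) (h : (X + Y)⁻¹ = 1) : X ⊓ Y ≤ s.star (X * Y) := by
  have hZ := inf_ne_zero hX.ne_zero hY.ne_zero
  have hXY : X + Y ≠ 0 := ne_zero_of_le hX.ne_zero le_self_add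
  set T := (X ⊓ Y) * (X⁻¹ * Y⁻¹) with hT
  have hTX : T * X ≤ 1 := calc
    T * X = ((X ⊓ Y) * Y⁻¹) * (X * X⁻¹) := by rw [hT]; ring
    _ ≤ (Y * Y⁻¹) * 1 :=
        mul_le_mul' (mul_le_mul_left inf_le_right _) (mul_inv_le_one X)
    _ ≤ 1 := by rw [mul_one]; exact mul_inv_le_one Y
  have hTY : T * Y ≤ 1 := calc
    T * Y = ((X ⊓ Y) * X⁻¹) * (Y * Y⁻¹) := by rw [hT]; ring
    _ ≤ (X * X⁻¹) * 1 :=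
        mul_le_mul' (mul_le_mul_left inf_le_left _) (mul_inv_le_one Y)
    _ ≤ 1 := by rw [mul_one]; exact mul_inv_le_one X
  have hT1 : T ≤ 1 := by
    rw [← h, le_inv_iff_mul_le_one hXY, mul_add, ← sup_eq_add]
    exact sup_le hTX hTY
  have hT0 : T ≠ 0 := mul_ne_zero hZ (mul_ne_zero hX.inv_ne_zero hY.inv_ne_zero)
  have hXY0 := mul_ne_zero hX.ne_zero hY.ne_zero
  have hZX := mul_ne_zero hZ (mul_ne_zero hX.ne_zero hX.inv_ne_zero)
  have hZXY := mul_ne_zero hZX (mul_ne_zero hY.ne_zero hY.inv_ne_zero)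
  calc X ⊓ Y ≤ s.star ((X ⊓ Y) * (X * X⁻¹)) := hX.le_star_mul_mul_inv _
    _ ≤ s.star ((X ⊓ Y) * (X * X⁻¹) * (Y * Y⁻¹)) :=
        star_le_of_le_star hZX hZXY (hY.le_star_mul_mul_inv _)
    _ = s.star (T * (X * Y)) := by rw [hT]; congr 1; ring
    _ ≤ s.star (X * Y) :=
        star_le_star (mul_ne_zero hT0 hXY0) (mul_le_of_le_one_left' hT1)

/-- If `X` and `Y` are `*`-invertible and `X + Y` has trivial inverse, then `(X + Y)* = D`. -/
theorem IsSharp.star_add_eq_one (hs : s.IsSharp) (hst : s.IsStable) {X Y : FractionalIdeal D⁰ K}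
    (hX : s.IsInvertible X) (hY : s.IsInvertible Y) (h : (X + Y)⁻¹ = 1) :
    s.star (X + Y) = 1 := by
  have hX0 := hX.ne_zero
  have hY0 := hY.ne_zero
  have hS0 : X + Y ≠ 0 := ne_zero_of_le hX0 le_self_add
  have hS1 : X + Y ≤ 1 := by
    have := mul_inv_le_one (X + Y)
    rwa [h, mul_one] at this
  have hX1 : X ≤ 1 := le_self_add.trans hS1
  have hY1 : Y ≤ 1 := le_add_self.trans hS1
  have hYY0 := mul_ne_zero hY0 hY0
  have hXY0 := mul_ne_zero hX0 hY0
  have hI0 : X + Y * Y ≠ 0 := ne_zero_of_le hX0 le_self_add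
  have hSS : (X + Y) * (X + Y) ≤ X + Y * Y := by
    rw [add_mul, mul_add Y, ← sup_eq_add, ← sup_eq_add (X)]
    refine sup_le ((mul_le_of_le_one_right' hS1).trans le_sup_left) ?_
    rw [← sup_eq_add]
    exact sup_le ((mul_le_of_le_one_left' hY1).trans le_sup_left) le_sup_right
  have hI1 : X + Y * Y ≤ 1 := by
    rw [← sup_eq_add]
    exact sup_le hX1 (mul_le_one' hY1 hY1)
  obtain ⟨H, J, hH, hJ, hHJ, hSH, hSJ⟩ := hs.exists_of_mul_le hI0 hS0 hS0 hSS
  have key : ∀ H J : FractionalIdeal D⁰ K, H ≠ 0 → J ≠ 0 → s.star (X + Y * Y) = s.star (H * J) →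
      X + Y ≤ s.star J → H ≤ s.star (X + Y) := by
    intro H J hH hJ hHJ hSJ
    have hHS : H * (X + Y) ≤ s.star (X + Y * Y) := by
      rw [hHJ]
      exact (mul_le_mul_right hSJ H).trans (s.mul_star_le _ hJ)
    have hH1 : H ≤ 1 := by
      rw [← h, le_inv_iff_mul_le_one hS0]
      exact hHS.trans (s.star_le_one hI0 hI1)
    refine hY.le_star_of_mul_le hH hS0 ?_
    have h1 : H * Y ≤ s.star (X + Y * Y) ⊓ s.star Y :=
      le_inf ((mul_le_mul_right le_add_self H).trans hHS)
        ((mul_le_of_le_one_left' hH1).trans (s.le_star Y hY0))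
    rw [← hst _ _ hI0 hY0] at h1
    refine h1.trans (star_le_of_le_star (inf_ne_zero hI0 hY0) (mul_ne_zero hS0 hY0) ?_)
    refine (add_inf_le_of_le (mul_le_of_le_one_left' hY1)).trans ?_
    rw [← sup_eq_add, add_mul]
    exact sup_le ((hX.inf_le_star_mul hY h).trans (star_le_star hXY0 le_self_add))
      (le_add_self.trans (s.le_star _ (ne_zero_of_le hXY0 le_self_add)))
  have hHS := key H J hH hJ hHJ hSJ
  have hJS := key J H hJ hH (by rw [hHJ, mul_comm]) hSH
  have hSS0 := mul_ne_zero hS0 hS0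
  have hXSS : X ≤ s.star ((X + Y) * (X + Y)) := calc
    X ≤ X + Y * Y := le_self_add
    _ ≤ s.star (X + Y * Y) := s.le_star _ hI0
    _ = s.star (H * J) := hHJ
    _ ≤ s.star (s.star (X + Y) * s.star (X + Y)) :=
        star_le_star (mul_ne_zero hH hJ) (mul_le_mul' hHS hJS)
    _ = s.star ((X + Y) * (X + Y)) := by
        rw [s.star_mul_star (s.star_ne_zero hS0) hS0, s.star_star_mul hS0 hS0]
  have hXYY : (X + Y * Y)⁻¹ = 1 := by
    refine le_antisymm ?_ ((le_inv_iff_mul_le_one hI0).2 (by rwa [one_mul]))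
    have h1 : (X + Y * Y)⁻¹ * (X + Y) ≤ 1 := by
      rw [← h, le_inv_iff_mul_le_one hS0, mul_assoc, ← le_inv_iff_mul_le_one hSS0]
      exact inv_anti_mono hSS0 hI0 hSS
    rwa [← le_inv_iff_mul_le_one hS0, h] at h1
  have hSX0 := mul_ne_zero hS0 hX0
  refine le_antisymm (s.star_le_one hS0 hS1) (hX.le_star_of_mul_le one_ne_zero hS0 ?_)
  rw [one_mul]
  have hSS' : (X + Y) * (X + Y) = Y * Y + (X + Y) * X := by
    have hidem : X * Y + X * Y = X * Y := by rw [← sup_eq_add, sup_idem]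
    calc (X + Y) * (X + Y) = X * X + (X * Y + X * Y) + Y * Y := by ring
      _ = Y * Y + (X + Y) * X := by rw [hidem]; ring
  have h2 : X ≤ s.star ((X + Y) * (X + Y)) ⊓ s.star X := le_inf hXSS (s.le_star X hX0)
  rw [← hst _ _ hSS0 hX0] at h2
  refine h2.trans (star_le_of_le_star (inf_ne_zero hSS0 hX0) hSX0 ?_)
  rw [hSS']
  refine (add_inf_le_of_le (mul_le_of_le_one_left' hS1)).trans ?_
  rw [← sup_eq_add]
  refine sup_le ?_ (s.le_star _ hSX0)
  rw [inf_comm]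
  refine (hX.inf_le_star_mul (hY.mul hY) hXYY).trans (star_le_star (mul_ne_zero hX0 hYY0) ?_)
  rw [mul_comm]
  exact mul_le_mul_left ((mul_le_of_le_one_left' hY1).trans le_add_self) X

theorem IsSharp.inv_mul_inv_eq_one (hs : s.IsSharp) {A : FractionalIdeal D⁰ K} (hA : A ≠ 0) :
    (A * A⁻¹)⁻¹ = 1 := by
  have hA' := hs.isInvertible_inv hA
  have h0 := mul_ne_zero hA hA'.ne_zero
  have h1 := inv_ne_zero' h0
  refine le_antisymm ?_ ((le_inv_iff_mul_le_one h0).2 (by simpa using mul_inv_le_one A))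
  refine (hA'.le_star_of_mul_le h1 one_ne_zero ?_).trans_eq s.star_one
  rw [one_mul, s.star_inv hA, le_inv_iff_mul_le_one hA, mul_assoc, mul_comm A⁻¹, mul_comm]
  exact mul_inv_le_one _

/-- In a `*`-sharp domain with `*` stable, sums of `*`-invertible ideals are `*`-invertible. -/
theorem IsSharp.isInvertible_add (hs : s.IsSharp) (hst : s.IsStable) {X Y : FractionalIdeal D⁰ K}
    (hX : s.IsInvertible X) (hY : s.IsInvertible Y) : s.IsInvertible (X + Y) := by
  have hS0 : X + Y ≠ 0 := ne_zero_of_le hX.ne_zero le_self_add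
  have hC := hs.isInvertible_inv hS0
  refine ⟨hS0, ?_⟩
  rw [add_mul]
  refine hs.star_add_eq_one hst (hX.mul hC) (hY.mul hC) ?_
  rw [← add_mul]
  exact hs.inv_mul_inv_eq_one hS0

theorem HasFiniteCharacter.exists_star_eq_star_spanFinset (hfc : s.HasFiniteCharacter)
    {I : FractionalIdeal D⁰ K} (hI : s.IsInvertible I) :
    ∃ T : Finset K, s.star I = s.star (spanFinset D T id) := by
  classical
  have h0 := mul_ne_zero hI.ne_zero hI.inv_ne_zero
  obtain ⟨H, hH, ⟨T, hT⟩, hHI, h1⟩ := hfc _ h0 1 (by rw [hI.2]; exact one_mem_one _)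
  have hfin : ∀ x : K, x ∈ I * I⁻¹ → ∃ U : Finset K, (U : Set K) ⊆ (I : Submodule D K) ∧
      x ∈ spanFinset D U id * I⁻¹ := by
    intro x hx
    obtain ⟨U, V, hU, hV, hx⟩ := mem_span_mul_finite_of_mem_mul hx
    refine ⟨U, hU, ?_⟩
    rw [← Submodule.span_mul_span] at hx
    rw [← FractionalIdeal.mem_coe, FractionalIdeal.coe_mul, spanFinset_coe, Set.image_id]
    exact mul_le_mul_right (Submodule.span_le.2 hV) _ hx
  choose! U hUI hU using hfin
  have hTI : ∀ x ∈ T, x ∈ I * I⁻¹ := fun x hx =>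
    hHI (FractionalIdeal.mem_coe.1 (hT ▸ Submodule.subset_span hx))
  set P := spanFinset D (T.biUnion U) (id : K → K) with hP
  have hPI : P ≤ I := by
    rw [← coe_le_coe, hP, spanFinset_coe, Set.image_id, Submodule.span_le]
    intro y hy
    obtain ⟨x, hx, hy⟩ := Finset.mem_biUnion.1 (Finset.mem_coe.1 hy)
    exact hUI x (hTI x hx) hy
  have hHP : H ≤ P * I⁻¹ := by
    rw [← coe_le_coe, ← hT, Submodule.span_le]
    intro x hx
    have hUP : spanFinset D (U x) (id : K → K) ≤ P := by
      rw [← coe_le_coe, hP, spanFinset_coe, spanFinset_coe, Set.image_id, Set.image_id]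
      exact Submodule.span_mono (Finset.coe_subset.2 (Finset.subset_biUnion_of_mem U hx))
    exact mul_le_mul_left hUP I⁻¹ (hU x (hTI x hx))
  have hP0 : P ≠ 0 := left_ne_zero_of_mul (ne_zero_of_le hH hHP)
  refine ⟨T.biUnion U, le_antisymm (star_le_of_le_star hI.ne_zero hP0 ?_)
    (star_le_star hP0 hPI)⟩
  have hIH := mul_ne_zero hI.ne_zero hH
  calc I ≤ I * s.star H := le_mul_of_one_le_right' (FractionalIdeal.one_le.2 h1)
    _ ≤ s.star (I * H) := s.mul_star_le _ hH
    _ ≤ s.star (I * (P * I⁻¹)) := star_le_star hIH (mul_le_mul_right hHP I)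
    _ = s.star (P * s.star (I * I⁻¹)) := by
        rw [s.star_mul_star hP0 h0]; congr 1; ring
    _ = s.star P := by rw [hI.2, mul_one]

variable (s) in
/-- The group of `*`-invertible `*`-closed fractional ideals, under `*`-multiplication and
ordered by inclusion. -/
def InvertibleIdeal : Type _ :=
  {I : FractionalIdeal D⁰ K // s.IsInvertible I ∧ s.star I = I}

namespace InvertibleIdeal

instance : PartialOrder s.InvertibleIdeal :=
  inferInstanceAs (PartialOrder {I : FractionalIdeal D⁰ K // s.IsInvertible I ∧ s.star I = I})

/-- The `*`-closure of a `*`-invertible fractional ideal. -/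
def mk (I : FractionalIdeal D⁰ K) (hI : s.IsInvertible I) : s.InvertibleIdeal :=
  ⟨s.star I, hI.star, s.star_star I hI.ne_zero⟩

theorem ne_zero (I : s.InvertibleIdeal) : I.1 ≠ 0 := I.2.1.ne_zero

noncomputable instance : CommGroup s.InvertibleIdeal where
  mul I J := mk (I.1 * J.1) (I.2.1.mul J.2.1)
  one := ⟨1, isInvertible_one, s.star_one⟩
  inv I := ⟨I.1⁻¹, I.2.1.inv, s.star_inv I.ne_zero⟩
  mul_assoc I J L := Subtype.ext <| by
    change s.star (s.star (I.1 * J.1) * L.1) = s.star (I.1 * s.star (J.1 * L.1))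
    rw [s.star_star_mul (mul_ne_zero I.ne_zero J.ne_zero) L.ne_zero,
      s.star_mul_star I.ne_zero (mul_ne_zero J.ne_zero L.ne_zero), mul_assoc]
  one_mul I := Subtype.ext <| by
    change s.star (1 * I.1) = I.1
    rw [one_mul, I.2.2]
  mul_one I := Subtype.ext <| by
    change s.star (I.1 * 1) = I.1
    rw [mul_one, I.2.2]
  inv_mul_cancel I := Subtype.ext <| by
    change s.star (I.1⁻¹ * I.1) = 1
    rw [mul_comm, I.2.1.2]
  mul_comm I J := Subtype.ext <| by
    change s.star (I.1 * J.1) = s.star (J.1 * I.1)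
    rw [mul_comm]

instance : IsOrderedMonoid s.InvertibleIdeal where
  mul_le_mul_left I J h L :=
    star_le_star (mul_ne_zero I.ne_zero L.ne_zero) (mul_le_mul_left (show I.1 ≤ J.1 from h) L.1)

theorem countable [Countable D] (hfc : s.HasFiniteCharacter) : Countable s.InvertibleIdeal := by
  have : Countable K := by
    refine Function.Surjective.countable (f := fun p : D × D => algebraMap D K p.1 / algebraMap D K p.2) ?_
    intro x
    obtain ⟨a, b, -, h⟩ := IsFractionRing.div_surjective (A := D) x
    exact ⟨(a, b), h⟩
  choose f hf using fun I : s.InvertibleIdeal => hfc.exists_star_eq_star_spanFinset I.2.1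
  refine Function.Injective.countable (f := f) fun I J h => Subtype.ext ?_
  rw [← I.2.2, ← J.2.2, hf, hf, h]

theorem exists_isLUB (hs : s.IsSharp) (S : Set s.InvertibleIdeal) (hne : S.Nonempty)
    (hb : BddAbove S) : ∃ z, IsLUB S z := by
  obtain ⟨w, hw⟩ := hb
  obtain ⟨I₀, hI₀⟩ := hne
  have hle : ∀ v ∈ upperBounds S, (⨆ I ∈ S, (I.1 : Submodule D K)) ≤ v.1 := fun v hv =>
    iSup₂_le fun I hI => coe_le_coe.2 (hv hI)
  let U : FractionalIdeal D⁰ K := ⟨⨆ I ∈ S, (I.1 : Submodule D K), isFractional_of_le (hle w hw)⟩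
  have hU : ∀ I ∈ S, I.1 ≤ U := fun I hI =>
    coe_le_coe.1 (le_iSup₂_of_le (f := fun (I : s.InvertibleIdeal) (_ : I ∈ S) =>
      (I.1 : Submodule D K)) I hI le_rfl)
  have hU0 : U ≠ 0 := ne_zero_of_le I₀.ne_zero (hU I₀ hI₀)
  have hU' := hs.isInvertible_inv hU0
  refine ⟨⟨U⁻¹⁻¹, hU'.inv, s.star_inv hU'.ne_zero⟩, fun I hI => ?_, fun v hv => ?_⟩
  · exact (hU I hI).trans (le_inv_inv hU0)
  · change U⁻¹⁻¹ ≤ v.1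
    have hUv : U ≤ v.1 := coe_le_coe.1 (hle v hv)
    rw [← v.2.2, ← v.2.1.inv_inv]
    exact inv_anti_mono v.2.1.inv_ne_zero hU'.ne_zero (inv_anti_mono hU0 v.ne_zero hUv)

end InvertibleIdeal

theorem IsSharp.star_eq_one_of_inv_eq_one [Countable D] (hs : s.IsSharp) (hst : s.IsStable)
    (hfc : s.HasFiniteCharacter) {B : FractionalIdeal D⁰ K} (hB : B ≠ 0) (hB' : B⁻¹ = 1) :
    s.star B = 1 := by
  have hcount := InvertibleIdeal.countable hfc
  have hsup := InvertibleIdeal.exists_isLUB hs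
  have hB1 : B ≤ 1 := by
    have := mul_inv_le_one B
    rwa [hB', mul_one] at this
  have hsB0 := s.star_ne_zero hB
  have hsB1 := s.star_le_one hB hB1
  have hnot : ∀ p : s.InvertibleIdeal, p < 1 → ¬ B ≤ p.1 := by
    intro p hp hBp
    have h1 : p⁻¹ ≤ 1 := by
      change p.1⁻¹ ≤ 1
      rw [← hB']
      exact inv_anti_mono hB p.ne_zero hBp
    exact hp.not_ge (inv_le_one'.1 h1)
  obtain ⟨a, ha, haB⟩ := exists_ne_zero_mem_isInteger hB
  have ha' : algebraMap D K a ≠ 0 := by simpa using ha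
  let u : s.InvertibleIdeal := InvertibleIdeal.mk _ (isInvertible_spanSingleton ha')
  have huB : u.1 ≤ s.star B :=
    star_le_star (spanSingleton_ne_zero_iff.2 ha') (spanSingleton_le_iff_mem.2 haB)
  have hfin := finite_maximal_lt_one_of_countable hsup (x := u) (huB.trans hsB1)
  obtain ⟨c, huc, hcB, hc⟩ : ∃ c : s.InvertibleIdeal, u ≤ c ∧ c.1 ≤ s.star B ∧
      ∀ p ∈ {p | u ≤ p ∧ Maximal (· < 1) p}, ¬ c ≤ p := by
    have hp : ∀ p ∈ {p | u ≤ p ∧ Maximal (· < 1) p}, p < 1 := fun p hp => hp.2.1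
    generalize {p | u ≤ p ∧ Maximal (· < 1) p} = T at hfin hp
    induction T, hfin using Set.Finite.induction_on with
    | empty => exact ⟨u, le_rfl, huB, by simp⟩
    | @insert q T _ _ ih =>
      obtain ⟨c, huc, hcB, hc⟩ := ih fun p hpT => hp p (Set.mem_insert_of_mem _ hpT)
      obtain ⟨b, hbB, hbq⟩ := SetLike.not_le_iff_exists.1 (hnot q (hp q (Set.mem_insert _ _)))
      have hb0 : b ≠ 0 := fun h => hbq (h ▸ FractionalIdeal.zero_mem _)
      have hinv := hs.isInvertible_add hst c.2.1 (isInvertible_spanSingleton (s := s) hb0)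
      have hcc : c ≤ InvertibleIdeal.mk _ hinv :=
        show c.1 ≤ s.star (c.1 + spanSingleton D⁰ b) from
          (le_self_add : c.1 ≤ c.1 + spanSingleton D⁰ b).trans (s.le_star _ hinv.ne_zero)
      refine ⟨InvertibleIdeal.mk _ hinv, huc.trans hcc, ?_, ?_⟩
      · refine star_le_of_le_star hinv.ne_zero hB ?_
        rw [← sup_eq_add]
        exact sup_le hcB (spanSingleton_le_iff_mem.2 (s.le_star B hB hbB))
      · rintro p (rfl | hpT) hle
        · exact hbq (hle (s.le_star _ hinv.ne_zero
            ((le_add_self : spanSingleton D⁰ b ≤ c.1 + _) (mem_spanSingleton_self _ b))))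
        · exact hc p hpT (hcc.trans hle)
  have hc1 : c = 1 := by
    by_contra hne
    have hlt : c < 1 := lt_of_le_of_ne (hcB.trans hsB1) hne
    obtain ⟨p, hcp, hp⟩ := exists_maximal_lt_one_of_countable hsup hlt
    exact hc p ⟨huc.trans hcp, hp⟩ hcp
  refine le_antisymm hsB1 ?_
  rw [hc1] at hcB
  exact hcB

end StarOperation

/-- Let `D` be a countable domain and `*` a stable star operation
of finite character on `D` such that `D` is `*`-sharp. Then `D` is `*`-Dedekind. -/
theorem statement10 (D : Type*) [CommRing D] [IsDomain D] [Countable D]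
    (K : Type*) [Field K] [Algebra D K] [IsFractionRing D K]
    (s : StarOperation D K) (hst : s.IsStable) (hfc : s.HasFiniteCharacter)
    (hsharp : s.IsSharp) :
    s.IsStarDedekind := by
  intro I hI
  exact hsharp.star_eq_one_of_inv_eq_one hst hfc
    (mul_ne_zero hI (hsharp.isInvertible_inv hI).ne_zero) (hsharp.inv_mul_inv_eq_one hI)
end

section
/- Let D be a t-sharp integral domain. Then D is a Prüfer v-multiplication domain (PVMD) of t-dimension at most 1, and for each maximal t-ideal M of D the localization D_M is a valuation domain whose value group is order-isomorphic to a complete subgroup of the additive reals. -/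
open scoped nonZeroDivisors

/-- A subgroup `G` of `(ℝ, +)` is complete if every nonempty subset of `G` which is
bounded above has a supremum in `G`. -/
def AddSubgroup.IsCompleteSubgroup (G : AddSubgroup ℝ) : Prop :=
  ∀ S : Set G, S.Nonempty → BddAbove S → ∃ g : G, IsLUB S g

/-- `R` is a valuation domain whose value group is order-isomorphic to a complete
subgroup of the additive reals. -/
def IsCompleteValuationDomain (R : Type*) [CommRing R] [IsDomain R] : Prop :=
  ∃ _ : ValuationRing R, ∃ G : AddSubgroup ℝ, G.IsCompleteSubgroup ∧
    Nonempty ((ValuationRing.ValueGroup R (FractionRing R))ˣ ≃*o Multiplicative G)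

section StarSharpDefs

variable {D K : Type*} [CommRing D] [IsDomain D] [Field K] [Algebra D K] [IsFractionRing D K]

/-- `M` is a maximal `*`-ideal for the operation `star`: maximal among the proper
nonzero integral `*`-ideals of `D`. -/
def IsMaxStarIdealOp (star : FractionalIdeal D⁰ K → FractionalIdeal D⁰ K) (M : Ideal D) : Prop :=
  M ≠ 0 ∧ M ≠ ⊤ ∧ star (M : FractionalIdeal D⁰ K) = (M : FractionalIdeal D⁰ K) ∧
    ∀ J : Ideal D, J ≠ ⊤ → star (J : FractionalIdeal D⁰ K) = (J : FractionalIdeal D⁰ K) →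
      M ≤ J → J = M

lemma inv_ne_zero' {I : FractionalIdeal D⁰ K} (hI : I ≠ 0) : I⁻¹ ≠ 0 := by
  obtain ⟨d, hd, hdI⟩ := I.isFractional
  have hmem : algebraMap D K d ∈ I⁻¹ := by
    rw [FractionalIdeal.mem_inv_iff hI]
    intro y hy
    obtain ⟨c, hc⟩ := hdI y hy
    refine ⟨c, trivial, ?_⟩
    simpa [Algebra.smul_def] using hc
  intro h0
  rw [h0] at hmem
  have : algebraMap D K d ≠ 0 :=
    IsFractionRing.to_map_ne_zero_of_mem_nonZeroDivisors hd
  exact this (by simpa using hmem)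

/-- The `v`-operation `I ↦ I_v = (I⁻¹)⁻¹`. -/
noncomputable def vOp (I : FractionalIdeal D⁰ K) : FractionalIdeal D⁰ K := (I⁻¹)⁻¹

lemma vOp_mono {I J : FractionalIdeal D⁰ K} (h : I ≤ J) : vOp I ≤ vOp J := by
  rcases eq_or_ne I 0 with rfl | hI
  · show ((0 : FractionalIdeal D⁰ K)⁻¹)⁻¹ ≤ vOp J
    rw [FractionalIdeal.inv_zero', FractionalIdeal.inv_zero']
    exact FractionalIdeal.zero_le _
  have hJ : J ≠ 0 := fun hJ0 => hI (le_antisymm (hJ0 ▸ h) (FractionalIdeal.zero_le I))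
  exact FractionalIdeal.inv_anti_mono (inv_ne_zero' hJ) (inv_ne_zero' hI)
    (FractionalIdeal.inv_anti_mono hI hJ h)

/-- The `t`-operation: `I_t` is the union of `H_v` over the finitely generated
subideals `H` of `I`. -/
noncomputable def tOp (I : FractionalIdeal D⁰ K) : FractionalIdeal D⁰ K :=
  ⟨⨆ J : {J : FractionalIdeal D⁰ K // (J : Submodule D K).FG ∧ J ≤ I},
      ((vOp (J : FractionalIdeal D⁰ K) : FractionalIdeal D⁰ K) : Submodule D K),
    FractionalIdeal.isFractional_of_le (J := vOp I)
      (iSup_le fun J => FractionalIdeal.coe_le_coe.2 (vOp_mono J.2.2))⟩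

end StarSharpDefs

section TOperation

open FractionalIdeal

variable {D K : Type*} [CommRing D] [Field K] [Algebra D K] [IsFractionRing D K]

lemma spanSingleton_mul_ne_zero {b : K} (hb : b ≠ 0) {F : FractionalIdeal D⁰ K} (hF : F ≠ 0) :
    spanSingleton D⁰ b * F ≠ 0 := by
  obtain ⟨x, hx, hx0⟩ : ∃ x ∈ F, x ≠ 0 := by
    by_contra! h
    exact hF (eq_zero_iff.2 h)
  exact fun h => mul_ne_zero hb hx0 (eq_zero_iff.1 h _ (mem_singleton_mul.2 ⟨x, hx, rfl⟩))

variable [IsDomain D]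

lemma mem_vOp_iff {J : FractionalIdeal D⁰ K} (hJ : J ≠ 0) {x : K} :
    x ∈ vOp J ↔ ∀ y ∈ J⁻¹, x * y ∈ (1 : FractionalIdeal D⁰ K) :=
  mem_inv_iff (inv_ne_zero' hJ)

lemma vOp_zero : vOp (0 : FractionalIdeal D⁰ K) = 0 := by
  rw [vOp, inv_zero', inv_zero']

lemma le_vOp (J : FractionalIdeal D⁰ K) : J ≤ vOp J := by
  rcases eq_or_ne J 0 with rfl | hJ
  · exact FractionalIdeal.zero_le _
  intro x hx
  rw [mem_vOp_iff hJ]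
  intro y hy
  rw [mul_comm]
  exact (mem_inv_iff hJ).1 hy x hx

lemma vOp_vOp_le (J : FractionalIdeal D⁰ K) : vOp (vOp J) ≤ vOp J := by
  rcases eq_or_ne J 0 with rfl | hJ
  · rw [vOp_zero, vOp_zero]
  have h : vOp (vOp J) = (vOp J⁻¹)⁻¹ := rfl
  have hv : vOp J⁻¹ ≠ 0 := inv_ne_zero' (inv_ne_zero' (inv_ne_zero' hJ))
  rw [h]
  exact inv_anti_mono (inv_ne_zero' hJ) hv (le_vOp _)

lemma vOp_spanSingleton (x : K) : vOp (spanSingleton D⁰ x) = spanSingleton D⁰ x := by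
  rw [vOp, spanSingleton_inv, spanSingleton_inv, inv_inv]

lemma mem_tOp_iff {I : FractionalIdeal D⁰ K} {x : K} :
    x ∈ tOp I ↔ ∃ J : FractionalIdeal D⁰ K, (J : Submodule D K).FG ∧ J ≤ I ∧ x ∈ vOp J := by
  have hne : Nonempty {J : FractionalIdeal D⁰ K // (J : Submodule D K).FG ∧ J ≤ I} :=
    ⟨⟨0, by simpa using Submodule.fg_bot, FractionalIdeal.zero_le _⟩⟩
  change x ∈ (⨆ J : {J : FractionalIdeal D⁰ K // (J : Submodule D K).FG ∧ J ≤ I},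
      ((vOp (J : FractionalIdeal D⁰ K) : FractionalIdeal D⁰ K) : Submodule D K)) ↔ _
  rw [Submodule.mem_iSup_of_directed]
  · simp only [Subtype.exists, exists_prop, and_assoc, FractionalIdeal.mem_coe]
  · rintro ⟨J, hJ, hJI⟩ ⟨J', hJ', hJI'⟩
    refine ⟨⟨J ⊔ J', ?_, sup_le hJI hJI'⟩, ?_, ?_⟩
    · rw [FractionalIdeal.coe_sup]
      exact hJ.sup hJ'
    · exact FractionalIdeal.coe_le_coe.2 (vOp_mono le_sup_left)
    · exact FractionalIdeal.coe_le_coe.2 (vOp_mono le_sup_right)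

lemma le_tOp (I : FractionalIdeal D⁰ K) : I ≤ tOp I := by
  intro x hx
  refine mem_tOp_iff.2 ⟨spanSingleton D⁰ x, ?_, ?_, le_vOp _ (mem_spanSingleton_self _ _)⟩
  · rw [coe_spanSingleton]
    exact Submodule.fg_span_singleton x
  · rwa [spanSingleton_le_iff_mem]

lemma tOp_mono {I J : FractionalIdeal D⁰ K} (h : I ≤ J) : tOp I ≤ tOp J := by
  intro x hx
  obtain ⟨F, hF, hFI, hx⟩ := mem_tOp_iff.1 hx
  exact mem_tOp_iff.2 ⟨F, hF, hFI.trans h, hx⟩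

lemma tOp_le_vOp (I : FractionalIdeal D⁰ K) : tOp I ≤ vOp I := by
  intro x hx
  obtain ⟨F, -, hFI, hx⟩ := mem_tOp_iff.1 hx
  exact vOp_mono hFI hx

lemma vOp_le_tOp {I : FractionalIdeal D⁰ K} (hI : (I : Submodule D K).FG) : vOp I ≤ tOp I :=
  fun _ hx => mem_tOp_iff.2 ⟨I, hI, le_rfl, hx⟩

lemma tOp_spanSingleton (x : K) : tOp (spanSingleton D⁰ x) = spanSingleton D⁰ x :=
  le_antisymm ((tOp_le_vOp _).trans (vOp_spanSingleton x).le) (le_tOp _)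

lemma tOp_one : tOp (1 : FractionalIdeal D⁰ K) = 1 := by
  rw [← spanSingleton_one, tOp_spanSingleton]

lemma exists_fg_le_vOp_of_le_tOp {I F : FractionalIdeal D⁰ K} (hF : (F : Submodule D K).FG)
    (hFI : F ≤ tOp I) : ∃ G : FractionalIdeal D⁰ K, (G : Submodule D K).FG ∧ G ≤ I ∧ F ≤ vOp G := by
  obtain ⟨s, hs⟩ := hF
  have key : ∀ s : Finset K, (∀ x ∈ s, x ∈ tOp I) →
      ∃ G : FractionalIdeal D⁰ K, (G : Submodule D K).FG ∧ G ≤ I ∧ ∀ x ∈ s, x ∈ vOp G := by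
    classical
    intro s
    induction s using Finset.induction_on with
    | empty =>
      intro _
      exact ⟨0, by simpa using Submodule.fg_bot, FractionalIdeal.zero_le _, by simp⟩
    | insert a s _ ih =>
      intro h
      obtain ⟨G, hG, hGI, hsG⟩ := ih fun x hx => h x (Finset.mem_insert_of_mem hx)
      obtain ⟨G', hG', hGI', haG'⟩ := mem_tOp_iff.1 (h a (Finset.mem_insert_self a s))
      refine ⟨G ⊔ G', ?_, sup_le hGI hGI', fun x hx => ?_⟩
      · rw [FractionalIdeal.coe_sup]
        exact hG.sup hG'
      · rcases Finset.mem_insert.1 hx with rfl | hx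
        · exact vOp_mono le_sup_right haG'
        · exact vOp_mono le_sup_left (hsG x hx)
  obtain ⟨G, hG, hGI, hsG⟩ := key s fun x hx => hFI <| by
    rw [← FractionalIdeal.mem_coe, ← hs]
    exact Submodule.subset_span hx
  refine ⟨G, hG, hGI, ?_⟩
  rw [← FractionalIdeal.coe_le_coe, ← hs, Submodule.span_le]
  exact hsG

lemma tOp_tOp (I : FractionalIdeal D⁰ K) : tOp (tOp I) = tOp I := by
  refine le_antisymm (fun x hx => ?_) (le_tOp _)
  obtain ⟨F, hF, hFI, hx⟩ := mem_tOp_iff.1 hx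
  obtain ⟨G, hG, hGI, hFG⟩ := exists_fg_le_vOp_of_le_tOp hF hFI
  exact mem_tOp_iff.2 ⟨G, hG, hGI, vOp_vOp_le G (vOp_mono hFG hx)⟩

lemma mul_vOp_le (b : K) (F : FractionalIdeal D⁰ K) :
    spanSingleton D⁰ b * vOp F ≤ vOp (spanSingleton D⁰ b * F) := by
  rcases eq_or_ne F 0 with rfl | hF
  · simp [vOp_zero]
  rcases eq_or_ne b 0 with rfl | hb
  · simp [vOp_zero]
  have hbF : spanSingleton D⁰ b * F ≠ 0 := spanSingleton_mul_ne_zero hb hF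
  intro x hx
  obtain ⟨z, hz, rfl⟩ := mem_singleton_mul.1 hx
  refine (mem_vOp_iff hbF).2 fun y hy => ?_
  have hyF : b * y ∈ F⁻¹ := (mem_inv_iff hF).2 fun w hw => by
    have := (mem_inv_iff hbF).1 hy (b * w) (mem_singleton_mul.2 ⟨w, hw, rfl⟩)
    rwa [← mul_assoc, mul_comm y b] at this
  have := (mem_vOp_iff hF).1 hz _ hyF
  rwa [← mul_assoc, mul_comm z b] at this

lemma tOp_mul_le (I J : FractionalIdeal D⁰ K) : tOp I * J ≤ tOp (I * J) := by
  refine FractionalIdeal.mul_le.2 fun x hx b hb => ?_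
  obtain ⟨F, hF, hFI, hx⟩ := mem_tOp_iff.1 hx
  refine mem_tOp_iff.2 ⟨spanSingleton D⁰ b * F, ?_, ?_, ?_⟩
  · rw [FractionalIdeal.coe_mul, coe_spanSingleton]
    exact (Submodule.fg_span_singleton b).mul hF
  · rw [mul_comm]
    exact FractionalIdeal.mul_le.2 fun i hi j hj =>
      FractionalIdeal.mul_mem_mul (hFI hi) ((spanSingleton_le_iff_mem).2 hb hj)
  · exact mul_vOp_le b F (mem_singleton_mul.2 ⟨x, hx, mul_comm _ _⟩)

lemma tOp_le_one {I : FractionalIdeal D⁰ K} (hI : I ≤ 1) : tOp I ≤ 1 :=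
  (tOp_mono hI).trans tOp_one.le

/-- A finitely generated `A` is `t`-invertible as soon as `(HJ)_t = aD`, `A ⊆ H_t` and
`aA⁻¹ ⊆ J_t` for some `H` and `J`. -/
lemma tOp_mul_inv_eq_one_of_factorization {a : K} (ha : a ≠ 0) {A H J : FractionalIdeal D⁰ K}
    (hA : A ≠ 0) (hfg : (A : Submodule D K).FG) (hHJ : tOp (H * J) = spanSingleton D⁰ a)
    (hAH : A ≤ tOp H) (hBJ : spanSingleton D⁰ a * A⁻¹ ≤ tOp J) : tOp (A * A⁻¹) = 1 := by
  have hsp : spanSingleton D⁰ a * spanSingleton D⁰ a⁻¹ = 1 := by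
    rw [spanSingleton_mul_spanSingleton, mul_inv_cancel₀ ha, spanSingleton_one]
  have hsp0 : spanSingleton D⁰ a ≠ 0 := spanSingleton_ne_zero_iff.2 ha
  have hA' : A⁻¹ ≠ 0 := inv_ne_zero' hA
  have hAJ : A * J ≤ spanSingleton D⁰ a :=
    ((mul_le_mul_left hAH J).trans (tOp_mul_le H J)).trans hHJ.le
  have hHB : spanSingleton D⁰ a * A⁻¹ * H ≤ spanSingleton D⁰ a :=
    ((mul_le_mul_left hBJ H).trans (tOp_mul_le J H)).trans ((mul_comm J H) ▸ hHJ.le)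
  have hcancel : ∀ {x : K}, a * x ∈ spanSingleton D⁰ a → x ∈ (1 : FractionalIdeal D⁰ K) := by
    intro x hx
    obtain ⟨z, hz⟩ := (mem_spanSingleton D⁰).1 hx
    refine (mem_one_iff D⁰).2 ⟨z, mul_left_cancel₀ ha ?_⟩
    rw [← hz, Algebra.smul_def, mul_comm]
  have hJle : J ≤ spanSingleton D⁰ a * A⁻¹ := by
    intro j hj
    refine mem_singleton_mul.2 ⟨a⁻¹ * j, (mem_inv_iff hA).2 fun y hy => hcancel ?_, ?_⟩
    · have := hAJ (FractionalIdeal.mul_mem_mul hy hj)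
      convert this using 1
      field_simp
    · field_simp
  have hHle : H ≤ tOp A := by
    refine le_trans ?_ (vOp_le_tOp hfg)
    intro x hx
    refine (mem_vOp_iff hA).2 fun y hy => hcancel ?_
    have := hHB (FractionalIdeal.mul_mem_mul (mem_singleton_mul.2 ⟨y, hy, rfl⟩) hx)
    convert this using 1
    ring
  have hle : A * A⁻¹ ≤ 1 := by
    refine FractionalIdeal.mul_le.2 fun x hx y hy => ?_
    rw [mul_comm]
    exact (mem_inv_iff hA).1 hy x hx
  refine le_antisymm (tOp_le_one hle) ?_
  have h1 : H * J ≤ spanSingleton D⁰ a * tOp (A * A⁻¹) := by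
    calc H * J ≤ tOp A * (spanSingleton D⁰ a * A⁻¹) := mul_le_mul' hHle hJle
      _ = spanSingleton D⁰ a * (tOp A * A⁻¹) := by ring
      _ ≤ _ := mul_le_mul_right (tOp_mul_le _ _) _
  have h2 : spanSingleton D⁰ a ≤ tOp (tOp (A * A⁻¹) * spanSingleton D⁰ a) := by
    refine hHJ.ge.trans ?_
    exact tOp_mono (h1.trans (mul_comm _ _).le)
  calc (1 : FractionalIdeal D⁰ K) = spanSingleton D⁰ a * spanSingleton D⁰ a⁻¹ := hsp.symm
    _ ≤ tOp (tOp (A * A⁻¹) * spanSingleton D⁰ a) * spanSingleton D⁰ a⁻¹ := mul_le_mul_left h2 _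
    _ ≤ tOp (tOp (A * A⁻¹) * spanSingleton D⁰ a * spanSingleton D⁰ a⁻¹) := tOp_mul_le _ _
    _ = tOp (A * A⁻¹) := by rw [mul_assoc, hsp, mul_one, tOp_tOp]

lemma IsSharpOp.tOp_mul_inv_eq_one (h : IsSharpOp (D := D) (K := K) tOp) {I : Ideal D}
    (hI : I ≠ 0) (hfg : I.FG) :
    tOp ((I : FractionalIdeal D⁰ K) * (I : FractionalIdeal D⁰ K)⁻¹) = 1 := by
  obtain ⟨a, haI, ha⟩ := Submodule.exists_mem_ne_zero_of_ne_bot hI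
  have ha' : algebraMap D K a ≠ 0 := by simpa using ha
  have hI' : (I : FractionalIdeal D⁰ K) ≠ 0 := coeIdeal_ne_zero.2 hI
  have hB1 : spanSingleton D⁰ (algebraMap D K a) * (I : FractionalIdeal D⁰ K)⁻¹ ≤ 1 := by
    intro x hx
    obtain ⟨y, hy, rfl⟩ := mem_singleton_mul.1 hx
    rw [mul_comm]
    exact (mem_inv_iff hI').1 hy _ (mem_coeIdeal_of_mem D⁰ haI)
  obtain ⟨B, hB⟩ := le_one_iff_exists_coeIdeal.1 hB1
  have hB0 : B ≠ 0 := by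
    refine (coeIdeal_ne_zero (K := K)).1 ?_
    rw [hB]
    exact spanSingleton_mul_ne_zero ha' (inv_ne_zero' hI')
  obtain ⟨H, J, -, -, hHJ, hH, hJ⟩ := h (Ideal.span {a}) I B (by simpa using ha) hI hB0 (by
    rw [← coeIdeal_le_coeIdeal K, coeIdeal_mul, hB, coeIdeal_span_singleton]
    calc (I : FractionalIdeal D⁰ K) *
          (spanSingleton D⁰ (algebraMap D K a) * (I : FractionalIdeal D⁰ K)⁻¹)
        = spanSingleton D⁰ (algebraMap D K a) *
          ((I : FractionalIdeal D⁰ K) * (I : FractionalIdeal D⁰ K)⁻¹) := by ring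
      _ ≤ spanSingleton D⁰ (algebraMap D K a) * 1 := mul_le_mul_right
          (FractionalIdeal.mul_le.2 fun x hx y hy => by
            rw [mul_comm]
            exact (mem_inv_iff hI').1 hy x hx) _
      _ = _ := mul_one _)
  refine tOp_mul_inv_eq_one_of_factorization ha' hI' ?_ ?_ hH (hB ▸ hJ)
  · rw [coe_coeIdeal]
    exact Submodule.FG.map _ hfg
  · rw [← hHJ, coeIdeal_span_singleton, tOp_spanSingleton]

end TOperation

lemma Localization.AtPrime.dvd_of_mul_eq_mul {D : Type*} [CommRing D] {Q : Ideal D} [Q.IsPrime]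
    {a b c d : D} (hc : c ∉ Q) (hcd : c * b = d * a) :
    algebraMap D (Localization.AtPrime Q) a ∣ algebraMap D (Localization.AtPrime Q) b := by
  have hu : IsUnit (algebraMap D (Localization.AtPrime Q) c) :=
    IsLocalization.map_units _ (⟨c, hc⟩ : Q.primeCompl)
  rw [← hu.dvd_mul_left, ← map_mul, hcd, map_mul]
  exact dvd_mul_left _ _

section PrimeTIdeal

open FractionalIdeal

variable {D K : Type*} [CommRing D] [IsDomain D] [Field K] [Algebra D K] [IsFractionRing D K]

lemma IsMaxStarIdealOp.isPrime {M : Ideal D} (hM : IsMaxStarIdealOp (D := D) (K := K) tOp M) :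
    M.IsPrime := by
  obtain ⟨-, hMtop, hMt, hmax⟩ := hM
  refine ⟨hMtop, fun {a b} hab => or_iff_not_imp_left.2 fun ha => ?_⟩
  obtain ⟨N, hN⟩ := le_one_iff_exists_coeIdeal.1
    (tOp_le_one (coeIdeal_le_one (I := M ⊔ Ideal.span {a}) : _ ≤ (1 : FractionalIdeal D⁰ K)))
  have hle : M ⊔ Ideal.span {a} ≤ N := by
    rw [← coeIdeal_le_coeIdeal K, hN]
    exact le_tOp _
  have hNtop : N = ⊤ := by
    by_contra hNtop
    have hNM := hmax N hNtop (by rw [hN, tOp_tOp]) (le_sup_left.trans hle)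
    exact ha (hNM ▸ hle (Ideal.mem_sup_right (Ideal.mem_span_singleton_self a)))
  have hb : algebraMap D K b ∈ (1 : FractionalIdeal D⁰ K) * (Ideal.span {b} : Ideal D) := by
    rw [one_mul]
    exact mem_coeIdeal_of_mem _ (Ideal.mem_span_singleton_self b)
  rw [hNtop, coeIdeal_top] at hN
  rw [hN] at hb
  have hbM : algebraMap D K b ∈ (M : FractionalIdeal D⁰ K) := by
    rw [← hMt]
    refine tOp_mono ?_ (tOp_mul_le _ _ hb)
    rw [← coeIdeal_mul, coeIdeal_le_coeIdeal, Ideal.sup_mul, sup_le_iff,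
      Ideal.span_singleton_mul_span_singleton, Ideal.span_singleton_le_iff_mem]
    exact ⟨Ideal.mul_le_left, hab⟩
  obtain ⟨c, hc, hcb⟩ := (mem_coeIdeal _).1 hbM
  exact IsFractionRing.injective D K hcb ▸ hc

variable {Q : Ideal D} [Q.IsPrime]

lemma not_mul_inv_le_prime (h : IsSharpOp (D := D) (K := K) tOp)
    (hQ : tOp (Q : FractionalIdeal D⁰ K) = Q) {I : Ideal D} (hI : I ≠ 0) (hfg : I.FG) :
    ¬ (I : FractionalIdeal D⁰ K) * (I : FractionalIdeal D⁰ K)⁻¹ ≤ Q := by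
  intro hle
  have h1 := tOp_mono hle
  rw [h.tOp_mul_inv_eq_one hI hfg, hQ, ← coeIdeal_top, coeIdeal_le_coeIdeal, top_le_iff] at h1
  exact Ideal.IsPrime.ne_top ‹_› h1

lemma exists_notMem_mul_mem_of_mem_tOp (h : IsSharpOp (D := D) (K := K) tOp)
    (hQ : tOp (Q : FractionalIdeal D⁰ K) = Q) {X : Ideal D} {x : D}
    (hx : algebraMap D K x ∈ tOp (X : FractionalIdeal D⁰ K)) : ∃ s ∉ Q, s * x ∈ X := by
  obtain ⟨F, hF, hFX, hx⟩ := mem_tOp_iff.1 hx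
  obtain ⟨H, rfl⟩ := le_one_iff_exists_coeIdeal.1 (hFX.trans coeIdeal_le_one)
  rcases eq_or_ne H 0 with rfl | hH
  · refine ⟨1, (Ideal.ne_top_iff_one Q).1 (Ideal.IsPrime.ne_top ‹_›), ?_⟩
    have : x = 0 := by simpa [vOp_zero] using hx
    simp [this]
  have hfg : H.FG := by
    rw [coe_coeIdeal] at hF
    exact (IsLocalization.coeSubmodule_fg K (IsFractionRing.injective D K) H).1 hF
  obtain ⟨z, hz, hzQ⟩ := Set.not_subset.1 (not_mul_inv_le_prime h hQ hH hfg)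
  have hH' : (H : FractionalIdeal D⁰ K) ≠ 0 := coeIdeal_ne_zero.2 hH
  have hz1 : z ∈ (1 : FractionalIdeal D⁰ K) := by
    refine FractionalIdeal.mul_le.2 (fun u hu w hw => ?_) hz
    rw [mul_comm]
    exact (mem_inv_iff hH').1 hw u hu
  obtain ⟨s, rfl⟩ := (mem_one_iff _).1 hz1
  refine ⟨s, fun hs => hzQ (mem_coeIdeal_of_mem _ hs), ?_⟩
  have hmul : (H : FractionalIdeal D⁰ K) * (H : FractionalIdeal D⁰ K)⁻¹ *
      spanSingleton D⁰ (algebraMap D K x) ≤ H := by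
    rw [mul_assoc]
    refine (mul_le_mul_right ?_ _).trans (mul_one _).le
    rw [mul_comm]
    intro y hy
    obtain ⟨w, hw, rfl⟩ := mem_singleton_mul.1 hy
    exact (mem_vOp_iff hH').1 hx w hw
  have hsx := hFX (hmul (FractionalIdeal.mul_mem_mul hz (mem_spanSingleton_self _ _)))
  rw [← map_mul] at hsx
  obtain ⟨c, hc, hcb⟩ := (mem_coeIdeal _).1 hsx
  exact IsFractionRing.injective D K hcb ▸ hc

lemma mem_map_of_mem_tOp (h : IsSharpOp (D := D) (K := K) tOp)
    (hQ : tOp (Q : FractionalIdeal D⁰ K) = Q) {X : Ideal D} {x : D}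
    (hx : algebraMap D K x ∈ tOp (X : FractionalIdeal D⁰ K)) :
    algebraMap D (Localization.AtPrime Q) x ∈ X.map (algebraMap D (Localization.AtPrime Q)) := by
  obtain ⟨s, hs, hsx⟩ := exists_notMem_mul_mem_of_mem_tOp h hQ hx
  rw [IsLocalization.mem_map_algebraMap_iff Q.primeCompl]
  exact ⟨(⟨_, hsx⟩, ⟨s, hs⟩), by simp [mul_comm]⟩

lemma map_le_map_of_le_tOp (h : IsSharpOp (D := D) (K := K) tOp)
    (hQ : tOp (Q : FractionalIdeal D⁰ K) = Q) {X Y : Ideal D}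
    (hX : (Y : FractionalIdeal D⁰ K) ≤ tOp (X : FractionalIdeal D⁰ K)) :
    Y.map (algebraMap D (Localization.AtPrime Q)) ≤
      X.map (algebraMap D (Localization.AtPrime Q)) :=
  Ideal.map_le_iff_le_comap.2 fun _ hy => mem_map_of_mem_tOp h hQ (hX (mem_coeIdeal_of_mem _ hy))

lemma valuationRing_localization (h : IsSharpOp (D := D) (K := K) tOp)
    (hQ : tOp (Q : FractionalIdeal D⁰ K) = Q) : ValuationRing (Localization.AtPrime Q) := by
  have key : ∀ a b : D,
      algebraMap D (Localization.AtPrime Q) a ∣ algebraMap D (Localization.AtPrime Q) b ∨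
      algebraMap D (Localization.AtPrime Q) b ∣ algebraMap D (Localization.AtPrime Q) a := by
    intro a b
    rcases eq_or_ne a 0 with rfl | ha
    · simp
    by_contra! hdvd
    have hI : Ideal.span {a, b} ≠ 0 := fun h0 =>
      ha (by simpa using (h0 ▸ Ideal.subset_span (by simp) : a ∈ (0 : Ideal D)))
    have hI' : ((Ideal.span {a, b} : Ideal D) : FractionalIdeal D⁰ K) ≠ 0 := coeIdeal_ne_zero.2 hI
    refine not_mul_inv_le_prime h hQ hI (Submodule.fg_span (Set.toFinite _)) (FractionalIdeal.mul_le.2 ?_)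
    intro i hi y hy
    have hmem : ∀ x ∈ Ideal.span {a, b}, ∃ c : D, algebraMap D K c = y * algebraMap D K x :=
      fun x hx => (mem_one_iff _).1 ((mem_inv_iff hI').1 hy _ (mem_coeIdeal_of_mem _ hx))
    obtain ⟨c, hc⟩ := hmem a (Ideal.subset_span (by simp))
    obtain ⟨d, hd⟩ := hmem b (Ideal.subset_span (by simp))
    have hcd : c * b = d * a := IsFractionRing.injective D K (by
      rw [map_mul, map_mul, hc, hd]; ring)
    have hcQ : c ∈ Q := by
      by_contra hcQ
      exact hdvd.1 (Localization.AtPrime.dvd_of_mul_eq_mul hcQ hcd)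
    have hdQ : d ∈ Q := by
      by_contra hdQ
      exact hdvd.2 (Localization.AtPrime.dvd_of_mul_eq_mul hdQ hcd.symm)
    obtain ⟨x, hx, rfl⟩ := (mem_coeIdeal _).1 hi
    obtain ⟨r, t, rfl⟩ := Ideal.mem_span_pair.1 hx
    refine (mem_coeIdeal _).2 ⟨r * c + t * d, Q.add_mem (Q.mul_mem_left r hcQ)
      (Q.mul_mem_left t hdQ), ?_⟩
    simp only [map_add, map_mul, hc, hd]
    ring
  refine { cond' := fun x y => ?_ }
  obtain ⟨a, b, s, hx, hy⟩ := IsLocalization.surj₂ Q.primeCompl (Localization.AtPrime Q) x y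
  have hu := IsLocalization.map_units (Localization.AtPrime Q) s
  have hxy := key a b
  rw [← hx, ← hy, hu.dvd_mul_right, hu.mul_right_dvd, hu.dvd_mul_right, hu.mul_right_dvd] at hxy
  rcases hxy with ⟨c, hc⟩ | ⟨c, hc⟩
  · exact ⟨c, Or.inl hc.symm⟩
  · exact ⟨c, Or.inr hc.symm⟩

end PrimeTIdeal

/-- In a valuation ring, every element of a product of two ideals is a product of two elements. -/
lemma ValuationRing.exists_mul_of_mem_mul {V : Type*} [CommRing V] [IsDomain V] [ValuationRing V]
    {H J : Ideal V} {a : V} (ha : a ∈ H * J) : ∃ x ∈ H, ∃ y ∈ J, x * y = a := by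
  refine Submodule.mul_induction_on ha (fun x hx y hy => ⟨x, hx, y, hy, rfl⟩) ?_
  rintro _ _ ⟨x, hx, y, hy, rfl⟩ ⟨x', hx', y', hy', rfl⟩
  obtain ⟨c, hc | hc⟩ := ValuationRing.cond (x * y) (x' * y')
  · exact ⟨x, hx, y * (1 + c), J.mul_mem_right _ hy, by rw [← hc]; ring⟩
  · exact ⟨x', hx', y' * (1 + c), J.mul_mem_right _ hy', by rw [← hc]; ring⟩

section LeastPrincipal

open FractionalIdeal

variable {D K : Type*} [CommRing D] [IsDomain D] [Field K] [Algebra D K] [IsFractionRing D K]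

/-- In the localization of a `t`-sharp domain at a prime `t`-ideal, every nonzero ideal is
contained in a least principal ideal. -/
lemma exists_least_principal_ideal {Q : Ideal D} [Q.IsPrime]
    (h : IsSharpOp (D := D) (K := K) tOp) (hQ : tOp (Q : FractionalIdeal D⁰ K) = Q)
    {A : Ideal (Localization.AtPrime Q)} (hA : A ≠ ⊥) :
    ∃ x, A ≤ Ideal.span {x} ∧ ∀ y, A ≤ Ideal.span {y} → y ∣ x := by
  have := valuationRing_localization h hQ
  set V := Localization.AtPrime Q
  have hmc : ∀ X : Ideal V, (X.comap (algebraMap D V)).map (algebraMap D V) = X :=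
    IsLocalization.map_under Q.primeCompl V
  have hne : ∀ {X : Ideal V}, X ≠ ⊥ → X.comap (algebraMap D V) ≠ 0 := by
    intro X hX h0
    rw [← hmc X, h0] at hX
    exact hX Ideal.map_bot
  obtain ⟨a, haA, ha⟩ := Submodule.exists_mem_ne_zero_of_ne_bot (hne hA)
  have haV : algebraMap D V a ≠ 0 := by
    rw [Ne, IsLocalization.to_map_eq_zero_iff V Q.primeCompl_le_nonZeroDivisors]
    exact ha
  let B : Ideal V := (Ideal.span {algebraMap D V a}).colon (A : Set V)
  have hmemB : ∀ c, c ∈ B ↔ ∀ y ∈ A, c * y ∈ Ideal.span {algebraMap D V a} := fun c =>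
    Submodule.mem_colon
  have haspan : Ideal.span {algebraMap D V a} ≠ ⊥ := by simpa using haV
  have hB : B ≠ ⊥ := fun h0 => haV (by
    have : algebraMap D V a ∈ B := (hmemB _).2 fun y _ =>
      Ideal.mul_mem_right _ _ (Ideal.mem_span_singleton_self _)
    simpa [h0] using this)
  obtain ⟨H, J, -, -, hHJ, hAH, hBJ⟩ := h _ _ _ (hne haspan) (hne hA) (hne hB) (by
    rw [Ideal.mul_le]
    intro r hr s hs
    rw [Ideal.mem_comap, map_mul, mul_comm]
    exact (hmemB _).1 hs _ hr)
  have hAH := map_le_map_of_le_tOp h hQ hAH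
  have hBJ := map_le_map_of_le_tOp h hQ hBJ
  rw [← coeIdeal_mul] at hHJ
  have hHJle := map_le_map_of_le_tOp h hQ ((le_tOp _).trans hHJ.ge)
  have hleHJ := map_le_map_of_le_tOp h hQ ((le_tOp _).trans hHJ.le)
  rw [hmc] at hAH hBJ hHJle hleHJ
  rw [Ideal.map_mul] at hHJle hleHJ
  obtain ⟨x, hx, y, hy, hxy⟩ := ValuationRing.exists_mul_of_mem_mul
    (hleHJ (Ideal.mem_span_singleton_self _))
  have hxy0 : x * y ≠ 0 := hxy ▸ haV
  refine ⟨x, fun z hz => ?_, fun z hz => ?_⟩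
  · have := hHJle (Ideal.mul_mem_mul (hAH hz) hy)
    rw [Ideal.mem_span_singleton, ← hxy] at this
    exact Ideal.mem_span_singleton.2 ((mul_dvd_mul_iff_right (right_ne_zero_of_mul hxy0)).1 this)
  · obtain ⟨c, hc⟩ := Ideal.mem_span_singleton.1 (hz haA)
    have hc0 : c ≠ 0 := right_ne_zero_of_mul (hc ▸ haV)
    have hcB : c ∈ B := (hmemB c).2 fun w hw => by
      obtain ⟨d, rfl⟩ := Ideal.mem_span_singleton.1 (hz hw)
      rw [hc]
      exact Ideal.mem_span_singleton.2 ⟨d, by ring⟩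
    have := hHJle (Ideal.mul_mem_mul hx (hBJ hcB))
    rw [Ideal.mem_span_singleton, hc] at this
    exact (mul_dvd_mul_iff_right hc0).1 this

end LeastPrincipal

/-- A linearly ordered commutative group in which every nonempty set of elements `≤ 1` has a
supremum is conditionally complete. -/
lemma exists_isLUB_of_le_one {G : Type*} [CommGroup G] [LinearOrder G] [IsOrderedMonoid G]
    (hG : ∀ S : Set G, S.Nonempty → (∀ s ∈ S, s ≤ 1) → ∃ g, IsLUB S g) {S : Set G}
    (hS : S.Nonempty) (hb : BddAbove S) : ∃ g, IsLUB S g := by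
  obtain ⟨b, hb⟩ := hb
  obtain ⟨g, hg⟩ := hG ((fun s => b⁻¹ * s) '' S) (hS.image _) (by
    rintro _ ⟨s, hs, rfl⟩
    exact inv_mul_le_one_iff.2 (hb hs))
  refine ⟨b * g, fun s hs => ?_, fun c hc => ?_⟩
  · exact inv_mul_le_iff_le_mul.1 (hg.1 ⟨s, hs, rfl⟩)
  · rw [← le_inv_mul_iff_mul_le]
    refine hg.2 ?_
    rintro _ ⟨s, hs, rfl⟩
    exact mul_le_mul_right (hc hs) _

/-- A conditionally complete linearly ordered commutative group is archimedean. -/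
lemma mulArchimedean_of_exists_isLUB {G : Type*} [CommGroup G] [LinearOrder G]
    [IsOrderedMonoid G] (hG : ∀ S : Set G, S.Nonempty → BddAbove S → ∃ g, IsLUB S g) :
    MulArchimedean G := by
  refine ⟨fun x y hy => ?_⟩
  by_contra! hlt
  obtain ⟨g, hg⟩ := hG (Set.range fun n : ℕ => y ^ n) (Set.range_nonempty _)
    ⟨x, by rintro _ ⟨n, rfl⟩; exact (hlt n).le⟩
  have hle : g ≤ g * y⁻¹ := hg.2 (by
    rintro _ ⟨n, rfl⟩
    rw [le_mul_inv_iff_mul_le]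
    exact hg.1 ⟨n + 1, pow_succ y n⟩)
  exact hy.not_ge (by simpa using hle)

/-- A conditionally complete linearly ordered commutative group is isomorphic to a complete
subgroup of the additive reals. -/
lemma exists_isCompleteSubgroup_equiv {G : Type*} [CommGroup G] [LinearOrder G]
    [IsOrderedMonoid G] (hG : ∀ S : Set G, S.Nonempty → BddAbove S → ∃ g, IsLUB S g) :
    ∃ H : AddSubgroup ℝ, H.IsCompleteSubgroup ∧ Nonempty (G ≃*o Multiplicative H) := by
  have := mulArchimedean_of_exists_isLUB hG
  obtain ⟨f, hf⟩ := Archimedean.exists_orderAddMonoidHom_real_injective (Additive G)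
  have hmono : StrictMono f := f.monotone'.strictMono_of_injective hf
  let H : AddSubgroup ℝ := (f : Additive G →+ ℝ).range
  let e : Additive G ≃+ H := AddMonoidHom.ofInjective (f := (f : Additive G →+ ℝ)) hf
  have he : ∀ {a b : Additive G}, e a ≤ e b ↔ a ≤ b := hmono.le_iff_le
  let o : G ≃o H :=
    { toEquiv := Additive.ofMul.trans e.toEquiv
      map_rel_iff' := he }
  refine ⟨H, fun S hS hb => ?_, ⟨⟨AddEquiv.toMultiplicativeRight e, he⟩⟩⟩
  obtain ⟨g, hg⟩ := hG (o ⁻¹' S) (hS.preimage o.surjective) ((o.bddAbove_preimage).2 hb)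
  exact ⟨o g, (o.isLUB_preimage').1 (by simpa using hg)⟩

namespace ValuationRing

variable {V : Type*} [CommRing V] [IsDomain V] [ValuationRing V]

lemma valuation_algebraMap_le_iff_dvd {x y : V} :
    valuation V (FractionRing V) (algebraMap V _ x) ≤
      valuation V (FractionRing V) (algebraMap V _ y) ↔ y ∣ x := by
  constructor
  · rintro ⟨c, hc⟩
    refine ⟨c, IsFractionRing.injective V (FractionRing V) ?_⟩
    rw [← hc, Algebra.smul_def, map_mul, mul_comm]
  · rintro ⟨c, rfl⟩
    exact ⟨c, by rw [Algebra.smul_def, map_mul, mul_comm]⟩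

lemma exists_valuation_algebraMap_eq {g : ValueGroup V (FractionRing V)} (hg : g ≤ 1) :
    ∃ x : V, valuation V (FractionRing V) (algebraMap V _ x) = g := by
  obtain ⟨z, rfl⟩ := Quotient.exists_rep g
  obtain ⟨x, rfl⟩ := (mem_integer_iff V (FractionRing V) z).1 hg
  exact ⟨x, rfl⟩

lemma exists_isLUB_valueGroup (hV : ∀ A : Ideal V, A ≠ ⊥ →
      ∃ x, A ≤ Ideal.span {x} ∧ ∀ y, A ≤ Ideal.span {y} → y ∣ x)
    (S : Set (ValueGroup V (FractionRing V))ˣ) (hS : S.Nonempty) (hb : BddAbove S) :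
    ∃ g, IsLUB S g := by
  refine exists_isLUB_of_le_one (fun S hS hS1 => ?_) hS hb
  let v := valuation V (FractionRing V)
  let A : Ideal V := Ideal.span {a | ∃ s ∈ S, v (algebraMap V _ a) = (s : ValueGroup V _)}
  have hA : ∀ s ∈ S, ∃ a ∈ A, a ≠ 0 ∧ v (algebraMap V _ a) = (s : ValueGroup V _) := by
    intro s hs
    obtain ⟨a, ha⟩ := exists_valuation_algebraMap_eq (V := V) (Units.val_le_val.2 (hS1 s hs))
    refine ⟨a, Ideal.subset_span ⟨s, hs, ha⟩, ?_, ha⟩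
    rintro rfl
    exact s.ne_zero (by rw [← ha]; simp)
  have hAle : ∀ {y : V}, (∀ s ∈ S, (s : ValueGroup V _) ≤ v (algebraMap V _ y)) →
      A ≤ Ideal.span {y} := by
    intro y hy
    refine Ideal.span_le.2 ?_
    rintro a ⟨s, hs, ha⟩
    exact Ideal.mem_span_singleton.2 (valuation_algebraMap_le_iff_dvd.1 (ha.le.trans (hy s hs)))
  obtain ⟨s₀, hs₀⟩ := hS
  obtain ⟨a₀, ha₀, hne, -⟩ := hA s₀ hs₀
  obtain ⟨x, hAx, hx⟩ := hV A (fun h0 => hne (by simpa [h0] using ha₀))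
  have hx0 : x ≠ 0 := by
    rintro rfl
    exact hne (by simpa using hAx ha₀)
  have hvx : v (algebraMap V _ x) ≠ 0 := by simpa using hx0
  refine ⟨Units.mk0 _ hvx, fun s hs => ?_, fun c hc => ?_⟩
  · obtain ⟨a, ha, -, hav⟩ := hA s hs
    rw [← Units.val_le_val, Units.val_mk0, ← hav]
    exact valuation_algebraMap_le_iff_dvd.2 (Ideal.mem_span_singleton.1 (hAx ha))
  · have hmin : ((min c 1 : (ValueGroup V (FractionRing V))ˣ) : ValueGroup V (FractionRing V)) ≤ 1 :=
      Units.val_le_val.2 (min_le_right c 1)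
    obtain ⟨y, hy⟩ := exists_valuation_algebraMap_eq (V := V) hmin
    refine le_trans ?_ (min_le_left c 1)
    rw [← Units.val_le_val, Units.val_mk0, ← hy]
    refine valuation_algebraMap_le_iff_dvd.2 (hx y (hAle fun s hs => ?_))
    exact (Units.val_le_val.2 (le_min (hc hs) (hS1 s hs))).trans hy.ge

lemma exists_dvd_pow (hV : ∀ A : Ideal V, A ≠ ⊥ →
      ∃ x, A ≤ Ideal.span {x} ∧ ∀ y, A ≤ Ideal.span {y} → y ∣ x)
    {p q : V} (hp : p ≠ 0) (hq : ¬ IsUnit q) : ∃ n : ℕ, p ∣ q ^ n := by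
  by_contra! hn
  have hdvd : ∀ n, ∃ r, q ^ n * r = p := fun n => by
    obtain ⟨c, hc | hc⟩ := ValuationRing.cond p (q ^ n)
    · exact absurd ⟨c, hc.symm⟩ (hn n)
    · exact ⟨c, hc⟩
  choose r hr using hdvd
  have hq0 : ∀ n, q ^ n ≠ 0 := fun n h0 => hn n (h0 ▸ dvd_zero p)
  have hmem : ∀ n, r n ∈ Ideal.span (Set.range r) := fun n => Ideal.subset_span ⟨n, rfl⟩
  have hr0 : ∀ n, r n ≠ 0 := fun n => right_ne_zero_of_mul (hr n ▸ hp)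
  obtain ⟨x, hx, hmin⟩ := hV (Ideal.span (Set.range r)) fun h0 =>
    hr0 0 (by simpa [h0] using hmem 0)
  have hx0 : x ≠ 0 := by
    rintro rfl
    exact hr0 0 (by simpa using hx (hmem 0))
  have hqx : q * x ∣ x := hmin _ (Ideal.span_le.2 (by
    rintro _ ⟨n, rfl⟩
    have hrn : r n = q * r (n + 1) :=
      mul_left_cancel₀ (hq0 n) (by rw [hr, ← mul_assoc, ← pow_succ, hr])
    rw [SetLike.mem_coe, hrn, Ideal.mem_span_singleton]
    exact mul_dvd_mul_left q (Ideal.mem_span_singleton.1 (hx (hmem _)))))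
  refine hq (isUnit_of_dvd_one ((mul_dvd_mul_iff_right hx0).1 ?_))
  rwa [one_mul]

end ValuationRing

/-- Let `D` be a `t`-sharp domain. Then `D` is a PVMD (every
nonzero finitely generated ideal is `t`-invertible) of `t`-dimension at most `1`,
and `D_M` is a valuation domain with value group a complete subgroup of the reals
for each maximal `t`-ideal `M` of `D`. -/
theorem statement11 (D : Type*) [CommRing D] [IsDomain D]
    (K : Type*) [Field K] [Algebra D K] [IsFractionRing D K]
    (h : IsSharpOp (D := D) (K := K) tOp) :
    (∀ I : Ideal D, I ≠ 0 → I.FG →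
      tOp ((I : FractionalIdeal D⁰ K) * (I : FractionalIdeal D⁰ K)⁻¹) = 1) ∧
    (∀ P Q : Ideal D, P ≠ 0 → P.IsPrime →
      tOp (P : FractionalIdeal D⁰ K) = (P : FractionalIdeal D⁰ K) → Q.IsPrime →
      tOp (Q : FractionalIdeal D⁰ K) = (Q : FractionalIdeal D⁰ K) → ¬ P < Q) ∧
    (∀ M : Ideal D, IsMaxStarIdealOp (D := D) (K := K) tOp M → ∃ _ : M.IsPrime,
      ∃ _ : IsDomain (Localization.AtPrime M),
        IsCompleteValuationDomain (Localization.AtPrime M)) := by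
  refine ⟨fun I hI hfg => h.tOp_mul_inv_eq_one hI hfg, fun P Q hP0 hP _ hQ hQt hPQ => ?_,
    fun M hM => ?_⟩
  · have := valuationRing_localization h hQt
    obtain ⟨hle, q, hq, hqP⟩ := SetLike.lt_iff_le_and_exists.1 hPQ
    obtain ⟨p, hp, hp0⟩ := Submodule.exists_mem_ne_zero_of_ne_bot hP0
    have hpV : algebraMap D (Localization.AtPrime Q) p ≠ 0 := by
      rwa [Ne, IsLocalization.to_map_eq_zero_iff _ Q.primeCompl_le_nonZeroDivisors]
    have hqV : ¬ IsUnit (algebraMap D (Localization.AtPrime Q) q) := by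
      rwa [IsLocalization.AtPrime.isUnit_to_map_iff (Localization.AtPrime Q) Q,
        Ideal.mem_primeCompl_iff, not_not]
    obtain ⟨n, hn⟩ := ValuationRing.exists_dvd_pow
      (fun A hA => exists_least_principal_ideal h hQt hA) hpV hqV
    have hmem : algebraMap D (Localization.AtPrime Q) (q ^ n) ∈
        P.map (algebraMap D (Localization.AtPrime Q)) := by
      rw [map_pow]
      exact Ideal.mem_of_dvd _ hn (Ideal.mem_map_of_mem _ hp)
    rw [IsLocalization.algebraMap_mem_map_algebraMap_iff Q.primeCompl] at hmem
    obtain ⟨s, hs, hsP⟩ := hmem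
    rcases hP.mem_or_mem hsP with hsP | hqn
    · exact hs (hle hsP)
    · exact hqP (hP.mem_of_pow_mem n hqn)
  · have hprime := hM.isPrime
    have hMt := hM.2.2.1
    refine ⟨hprime, inferInstance, valuationRing_localization h hMt, ?_⟩
    have := valuationRing_localization h hMt
    exact exists_isCompleteSubgroup_equiv (ValuationRing.exists_isLUB_valueGroup
      fun A hA => exists_least_principal_ideal h hMt hA)
end
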